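/- arXiv:1305.3774 — 9 statements merged into one kernel-verified Lean document; each statement's English description precedes it below -/
import Mathlib

section
/- Let C be a clique of G containing node i, and suppose the stability condition ρ_j ≤ θ_j holds for all j ∈ C. Then σ_i (1 − ρ_C) ≥ ρ_i; in particular, if ρ_C < 1 then σ_i ≥ ρ_i/(1 − ρ_C). -/
open Finset

/-- If every set of a family meets `C` in at most one point, then the total weights of the sets
through the various points of `C` and of the sets disjoint from `C` add up to at most the weight of
the whole family. -/
theorem sum_sum_filter_mem_add_sum_filter_disjoint_le {V : Type*} [DecidableEq V]
    (Ω : Finset (Finset V)) (C : Finset V) (hΩ : ∀ s ∈ Ω, #(C ∩ s) ≤ 1)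
    (w : Finset V → ℝ) (hw : ∀ s ∈ Ω, 0 ≤ w s) :
    ∑ j ∈ C, ∑ s ∈ Ω with j ∈ s, w s + ∑ s ∈ Ω with Disjoint C s, w s ≤ ∑ s ∈ Ω, w s := by
  simp_rw [sum_filter]
  rw [sum_comm, ← sum_add_distrib]
  refine sum_le_sum fun s hs => ?_
  rw [← sum_filter, filter_mem_eq_inter, sum_const, nsmul_eq_mul]
  split_ifs with h
  · simp [disjoint_iff_inter_eq_empty.mp h]
  · rw [add_zero]
    exact mul_le_of_le_one_left (hw s hs) (by exact_mod_cast hΩ s hs)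

/-- Removing `i` maps the independent sets containing `i` injectively into the independent sets
disjoint from a given clique through `i`, and divides the product weight by `σ i`. -/
theorem sum_filter_mem_prod_le_mul_sum_filter_disjoint {V : Type*} [DecidableEq V]
    (Ω : Finset (Finset V)) (C : Finset V) (σ : V → ℝ) (hσ : ∀ j, 0 < σ j) (i : V)
    (herase : ∀ s ∈ Ω, i ∈ s → s.erase i ∈ Ω ∧ Disjoint C (s.erase i)) :
    ∑ s ∈ Ω with i ∈ s, ∏ j ∈ s, σ j ≤ σ i * ∑ s ∈ Ω with Disjoint C s, ∏ j ∈ s, σ j := by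
  have hinj : Set.InjOn (fun s : Finset V => s.erase i) ↑{s ∈ Ω | i ∈ s} := by
    intro s hs t ht hst
    simp only [coe_filter, Set.mem_ofPred_eq] at hs ht
    rw [← insert_erase hs.2, ← insert_erase ht.2]
    exact congrArg (insert i) hst
  calc ∑ s ∈ Ω with i ∈ s, ∏ j ∈ s, σ j
      = σ i * ∑ s ∈ Ω with i ∈ s, ∏ j ∈ s.erase i, σ j := by
        rw [mul_sum]
        exact sum_congr rfl fun s hs => (mul_prod_erase s σ (mem_filter.mp hs).2).symm
    _ = σ i * ∑ t ∈ image (fun s => s.erase i) {s ∈ Ω | i ∈ s}, ∏ j ∈ t, σ j := by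
        rw [sum_image hinj]
    _ ≤ σ i * ∑ s ∈ Ω with Disjoint C s, ∏ j ∈ s, σ j := by
        refine mul_le_mul_of_nonneg_left (sum_le_sum_of_subset_of_nonneg ?_ ?_) (hσ i).le
        · rw [image_subset_iff]
          intro s hs
          rw [mem_filter] at hs
          exact mem_filter.mpr (herase s hs.1 hs.2)
        · exact fun t _ _ => prod_nonneg fun j _ => (hσ j).le

/-- Let `C` be a clique of `G` containing node `i`, and suppose the
stability condition `ρ_j ≤ θ_j` holds for all `j ∈ C`.  Then `σ_i (1 − ρ_C) ≥ ρ_i`;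
in particular, if `ρ_C < 1` then `σ_i ≥ ρ_i / (1 − ρ_C)`. -/
theorem sigma_lower_bound_of_stability
    {V : Type*} [Fintype V] [DecidableEq V] (G : SimpleGraph V) [DecidableRel G.Adj]
    (σ : V → ℝ) (hσ : ∀ i, 0 < σ i)
    (Ω : Finset (Finset V))
    (hΩ : ∀ s : Finset V, s ∈ Ω ↔ ∀ i ∈ s, ∀ j ∈ s, i ≠ j → ¬ G.Adj i j)
    (Z : ℝ) (hZ : Z = ∑ s ∈ Ω, ∏ i ∈ s, σ i)
    (π : Finset V → ℝ) (hπ : ∀ s, π s = (∏ i ∈ s, σ i) / Z)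
    (θ : V → ℝ) (hθ : ∀ i, θ i = ∑ s ∈ Ω.filter (fun s => i ∈ s), π s)
    (ρ : V → ℝ) (hρ : ∀ j, 0 ≤ ρ j)
    (C : Finset V) (hC : ∀ i ∈ C, ∀ j ∈ C, i ≠ j → G.Adj i j)
    (i : V) (hiC : i ∈ C)
    (hstab : ∀ j ∈ C, ρ j ≤ θ j) :
    σ i * (1 - ∑ j ∈ C, ρ j) ≥ ρ i ∧
    (∑ j ∈ C, ρ j < 1 → σ i ≥ ρ i / (1 - ∑ j ∈ C, ρ j)) := by
  have hZpos : 0 < Z := by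
    rw [hZ]
    exact sum_pos (fun s _ => prod_pos fun j _ => hσ j) ⟨∅, (hΩ ∅).mpr (by simp)⟩
  have hπnonneg : ∀ s ∈ Ω, 0 ≤ π s := fun s _ => by
    rw [hπ]
    exact div_nonneg (prod_nonneg fun j _ => (hσ j).le) hZpos.le
  have hπsum : ∑ s ∈ Ω, π s = 1 := by
    simp_rw [hπ]
    rw [← sum_div, ← hZ, div_self hZpos.ne']
  have hcard : ∀ s ∈ Ω, #(C ∩ s) ≤ 1 := by
    intro s hs
    refine card_le_one.mpr fun a ha b hb => by_contra fun hab => ?_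
    rw [mem_inter] at ha hb
    exact (hΩ s).mp hs a ha.2 b hb.2 hab (hC a ha.1 b hb.1 hab)
  have herase : ∀ s ∈ Ω, i ∈ s → s.erase i ∈ Ω ∧ Disjoint C (s.erase i) := by
    intro s hs his
    refine ⟨(hΩ _).mpr fun a ha b hb => (hΩ s).mp hs a (mem_of_mem_erase ha) b
      (mem_of_mem_erase hb), disjoint_left.mpr fun a haC has => ?_⟩
    have hai := ne_of_mem_erase has
    exact (hΩ s).mp hs a (mem_of_mem_erase has) i his hai (hC a haC i hiC hai)
  have hθC : ∑ j ∈ C, θ j + ∑ s ∈ Ω with Disjoint C s, π s ≤ 1 := by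
    simp_rw [hθ]
    exact (sum_sum_filter_mem_add_sum_filter_disjoint_le Ω C hcard π hπnonneg).trans_eq hπsum
  have hθi : θ i ≤ σ i * ∑ s ∈ Ω with Disjoint C s, π s := by
    rw [hθ]
    simp_rw [hπ]
    rw [← sum_div, ← sum_div, ← mul_div_assoc]
    exact div_le_div_of_nonneg_right
      (sum_filter_mem_prod_le_mul_sum_filter_disjoint Ω C σ hσ i herase) hZpos.le
  have hmain : ρ i ≤ σ i * (1 - ∑ j ∈ C, ρ j) := by
    refine ((hstab i hiC).trans hθi).trans (mul_le_mul_of_nonneg_left ?_ (hσ i).le)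
    linarith [sum_le_sum hstab]
  exact ⟨hmain, fun h => (div_le_iff₀ (sub_pos.mpr h)).mpr hmain⟩
end

section
/- Suppose Σ_{i∈C} E[L'_i] ≤ Σ_{i∈C} E[L_i] and (1 − ρ_C) Σ_{i∈C} E[f(L'_i)] ≥ Σ_{i∈C} ρ_i E[g(L_i)]. Then, writing S = Σ_{i∈C} E[L_i], one has |C| f(S) (1 − ρ_C) ≥ ρ_C g(S); equivalently, h(S) ≥ (1/|C|) · ρ_C/(1 − ρ_C) where h = f/g. (This is the key inequality in Theorem 1(iii), showing that the mean aggregate queue length in a clique is at least h^{−1}( (1/|C|) ρ_C/(1−ρ_C) ).) -/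
open Finset MeasureTheory

/-- A convex function on a real set has a supporting line at every interior point. -/
theorem ConvexOn.exists_supporting_line {s : Set ℝ} {g : ℝ → ℝ} (hg : ConvexOn ℝ s g)
    {m : ℝ} (hm : m ∈ interior s) : ∃ c : ℝ, ∀ y ∈ s, g m + c * (y - m) ≤ g y := by
  refine ⟨derivWithin g (Set.Ioi m) m, fun y hy => ?_⟩
  rcases lt_trichotomy m y with h | rfl | h
  · have h1 := hg.rightDeriv_le_slope_of_mem_interior hm hy h
    rw [slope_def_field, le_div_iff₀ (sub_pos.2 h)] at h1
    linarith
  · simp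
  · have h1 := (hg.slope_le_leftDeriv_of_mem_interior hy hm h).trans
      (hg.leftDeriv_le_rightDeriv_of_mem_interior hm)
    rw [slope_def_field, div_le_iff₀ (sub_pos.2 h)] at h1
    linarith

/-- Jensen's inequality for a nonnegative random variable and a convex function on `[0, ∞)`
that is not assumed continuous at `0`. -/
theorem ConvexOn.map_integral_le_of_nonneg {X : Type*} [MeasurableSpace X] {P : Measure X}
    [IsProbabilityMeasure P] {g : ℝ → ℝ} (hg : ConvexOn ℝ (Set.Ici 0) g) {Y : X → ℝ}
    (hY : ∀ x, 0 ≤ Y x) (hYint : Integrable Y P) (hgint : Integrable (fun x => g (Y x)) P) :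
    g (∫ x, Y x ∂P) ≤ ∫ x, g (Y x) ∂P := by
  rcases (integral_nonneg (μ := P) hY : 0 ≤ ∫ x, Y x ∂P).eq_or_lt with h0 | hpos
  · have hae : Y =ᵐ[P] 0 := (integral_eq_zero_iff_of_nonneg hY hYint).1 h0.symm
    have hcongr : ∫ x, g (Y x) ∂P = ∫ _, g 0 ∂P :=
      integral_congr_ae (hae.mono fun x hx => congrArg g hx)
    rw [hcongr, ← h0]
    simp
  · obtain ⟨c, hc⟩ := hg.exists_supporting_line (m := ∫ x, Y x ∂P) (by simpa using hpos)
    have hlin : Integrable (fun x => c * (Y x - ∫ z, Y z ∂P)) P :=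
      (hYint.sub (integrable_const _)).const_mul c
    calc g (∫ x, Y x ∂P)
        = ∫ x, (g (∫ z, Y z ∂P) + c * (Y x - ∫ z, Y z ∂P)) ∂P := by
          rw [integral_add (integrable_const _) hlin, integral_const_mul,
            integral_sub hYint (integrable_const _)]
          simp
      _ ≤ ∫ x, g (Y x) ∂P :=
          integral_mono ((integrable_const _).add hlin) hgint fun x => hc _ (hY x)

/-- Jensen's inequality for a nonnegative random variable and a concave function on `[0, ∞)`
that is not assumed continuous at `0`. -/
theorem ConcaveOn.le_map_integral_of_nonneg {X : Type*} [MeasurableSpace X] {P : Measure X}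
    [IsProbabilityMeasure P] {f : ℝ → ℝ} (hf : ConcaveOn ℝ (Set.Ici 0) f) {Y : X → ℝ}
    (hY : ∀ x, 0 ≤ Y x) (hYint : Integrable Y P) (hfint : Integrable (fun x => f (Y x)) P) :
    ∫ x, f (Y x) ∂P ≤ f (∫ x, Y x ∂P) := by
  have h := hf.neg.map_integral_le_of_nonneg hY hYint hfint.neg
  simp only [Pi.neg_apply, integral_neg] at h
  linarith

/-- Key inequality of Theorem 1(iii): if
`Σ_{i∈C} E[L'_i] ≤ Σ_{i∈C} E[L_i]` and
`(1 − ρ_C) Σ_{i∈C} E[f(L'_i)] ≥ Σ_{i∈C} ρ_i E[g(L_i)]`, then, with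
`S = Σ_{i∈C} E[L_i]`, one has `|C| f(S) (1 − ρ_C) ≥ ρ_C g(S)`, equivalently
`h(S) = f(S)/g(S) ≥ (1/|C|) ρ_C/(1 − ρ_C)`. -/
theorem nominal_activation_queue_bound
    {X : Type*} [MeasurableSpace X] (P : Measure X) [IsProbabilityMeasure P]
    {ι : Type*} (C : Finset ι) (hCne : C.Nonempty)
    (L L' : ι → X → ℝ)
    (hLmeas : ∀ i ∈ C, Measurable (L i)) (hL'meas : ∀ i ∈ C, Measurable (L' i))
    (hLnonneg : ∀ i ∈ C, ∀ x, 0 ≤ L i x) (hL'nonneg : ∀ i ∈ C, ∀ x, 0 ≤ L' i x)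
    (hLint : ∀ i ∈ C, Integrable (L i) P) (hL'int : ∀ i ∈ C, Integrable (L' i) P)
    (f : ℝ → ℝ) (hfmono : MonotoneOn f (Set.Ici (0:ℝ)))
    (hfconc : ConcaveOn ℝ (Set.Ici (0:ℝ)) f)
    (hfnonneg : ∀ x : ℝ, 0 ≤ x → 0 ≤ f x)
    (hfint : ∀ i ∈ C, Integrable (fun x => f (L' i x)) P)
    (g : ℝ → ℝ) (hganti : AntitoneOn g (Set.Ici (0:ℝ)))
    (hgconv : ConvexOn ℝ (Set.Ici (0:ℝ)) g)
    (hgpos : ∀ x : ℝ, 0 ≤ x → 0 < g x)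
    (hgint : ∀ i ∈ C, Integrable (fun x => g (L i x)) P)
    (ρ : ι → ℝ) (hρ : ∀ i ∈ C, 0 ≤ ρ i)
    (ρC : ℝ) (hρCdef : ρC = ∑ i ∈ C, ρ i) (hρC0 : 0 < ρC) (hρC1 : ρC < 1)
    (hyp1 : ∑ i ∈ C, ∫ x, L' i x ∂P ≤ ∑ i ∈ C, ∫ x, L i x ∂P)
    (hyp2 : (1 - ρC) * ∑ i ∈ C, ∫ x, f (L' i x) ∂P
              ≥ ∑ i ∈ C, ρ i * ∫ x, g (L i x) ∂P) :
    (C.card : ℝ) * f (∑ i ∈ C, ∫ x, L i x ∂P) * (1 - ρC)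
        ≥ ρC * g (∑ i ∈ C, ∫ x, L i x ∂P) ∧
    f (∑ i ∈ C, ∫ x, L i x ∂P) / g (∑ i ∈ C, ∫ x, L i x ∂P)
        ≥ (1 / (C.card : ℝ)) * (ρC / (1 - ρC)) := by
  have hL0 : ∀ i ∈ C, 0 ≤ ∫ x, L i x ∂P := fun i hi => integral_nonneg (hLnonneg i hi)
  have hL'0 : ∀ i ∈ C, 0 ≤ ∫ x, L' i x ∂P := fun i hi => integral_nonneg (hL'nonneg i hi)
  have hS0 := Finset.sum_nonneg hL0
  have hf_le : ∑ i ∈ C, ∫ x, f (L' i x) ∂P ≤ C.card * f (∑ i ∈ C, ∫ x, L i x ∂P) := by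
    rw [← nsmul_eq_mul]
    refine Finset.sum_le_card_nsmul _ _ _ fun i hi => ?_
    exact (hfconc.le_map_integral_of_nonneg (hL'nonneg i hi) (hL'int i hi) (hfint i hi)).trans
      (hfmono (hL'0 i hi) hS0 ((Finset.single_le_sum hL'0 hi).trans hyp1))
  have hg_le : ρC * g (∑ i ∈ C, ∫ x, L i x ∂P) ≤ ∑ i ∈ C, ρ i * ∫ x, g (L i x) ∂P := by
    rw [hρCdef, Finset.sum_mul]
    refine Finset.sum_le_sum fun i hi => mul_le_mul_of_nonneg_left ?_ (hρ i hi)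
    exact (hganti (hL0 i hi) hS0 (Finset.single_le_sum hL0 hi)).trans
      (hgconv.map_integral_le_of_nonneg (hLnonneg i hi) (hLint i hi) (hgint i hi))
  have hρ1 : 0 < 1 - ρC := sub_pos.2 hρC1
  have hmain : ρC * g (∑ i ∈ C, ∫ x, L i x ∂P)
      ≤ C.card * f (∑ i ∈ C, ∫ x, L i x ∂P) * (1 - ρC) := by
    have := mul_le_mul_of_nonneg_left hf_le hρ1.le
    linarith
  refine ⟨hmain, ?_⟩
  have hcard : (0 : ℝ) < C.card := by exact_mod_cast hCne.card_pos
  rw [ge_iff_le, div_mul_div_comm, one_mul, div_le_div_iff₀ (by positivity) (hgpos _ hS0)]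
  linarith
end

section
/- For any clique C of G and any i ∈ C, the hard-core measure satisfies θ_i ≤ (σ_i/(1+σ_i)) (1 − Σ_{j∈C∖{i}} θ_j). -/
open Finset

/-- For any clique `C` of `G` and any `i ∈ C`, the hard-core measure
satisfies `θ_i ≤ (σ_i/(1+σ_i)) (1 − Σ_{j∈C∖{i}} θ_j)`. -/
theorem hardcore_theta_clique_upper_bound
    {V : Type*} [Fintype V] [DecidableEq V] (G : SimpleGraph V) [DecidableRel G.Adj]
    (σ : V → ℝ) (hσ : ∀ i, 0 < σ i)
    (Ω : Finset (Finset V))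
    (hΩ : ∀ s : Finset V, s ∈ Ω ↔ ∀ i ∈ s, ∀ j ∈ s, i ≠ j → ¬ G.Adj i j)
    (Z : ℝ) (hZ : Z = ∑ s ∈ Ω, ∏ i ∈ s, σ i)
    (π : Finset V → ℝ) (hπ : ∀ s, π s = (∏ i ∈ s, σ i) / Z)
    (θ : V → ℝ) (hθ : ∀ i, θ i = ∑ s ∈ Ω.filter (fun s => i ∈ s), π s)
    (C : Finset V) (hC : ∀ i ∈ C, ∀ j ∈ C, i ≠ j → G.Adj i j)
    (i : V) (hiC : i ∈ C) :
    θ i ≤ (σ i / (1 + σ i)) * (1 - ∑ j ∈ C.erase i, θ j) := by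
  have hw : ∀ s : Finset V, 0 < ∏ i ∈ s, σ i := fun s => prod_pos fun i _ => hσ i
  have hempty : (∅ : Finset V) ∈ Ω := (hΩ ∅).2 (by simp)
  have hZpos : 0 < Z := hZ ▸ sum_pos (fun s _ => hw s) ⟨∅, hempty⟩
  have hπ0 : ∀ s, 0 ≤ π s := fun s => by
    rw [hπ]
    exact (div_pos (hw s) hZpos).le
  have htotal : ∑ s ∈ Ω, π s = 1 := by
    simp only [hπ]
    rw [← sum_div, ← hZ, div_self (ne_of_gt hZpos)]
  -- A feasible state meets the clique in at most one vertex.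
  have hpartition : ∑ j ∈ C, θ j + ∑ s ∈ Ω with Disjoint s C, π s = 1 := by
    simp only [hθ, sum_filter]
    rw [sum_comm, ← sum_add_distrib, ← htotal]
    refine sum_congr rfl fun s hs => ?_
    by_cases hd : Disjoint s C
    · rw [if_pos hd, sum_eq_zero, zero_add]
      exact fun j hj => if_neg fun hjs => disjoint_left.1 hd hjs hj
    · obtain ⟨k, hks, hkC⟩ := not_disjoint_iff.1 hd
      rw [if_neg hd, add_zero, sum_eq_single_of_mem k hkC, if_pos hks]
      exact fun j hj hjk => if_neg fun hjs => (hΩ s).1 hs j hjs k hks hjk (hC j hj k hkC hjk)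
  -- Deactivating `i` leaves a feasible state disjoint from the clique.
  have hflip : θ i ≤ σ i * ∑ s ∈ Ω with Disjoint s C, π s := by
    have hinj : Set.InjOn (fun s : Finset V => s.erase i)
        (Ω.filter (fun s => i ∈ s) : Finset (Finset V)) := by
      intro s hs t ht hst
      have his : i ∈ s := (mem_filter.1 hs).2
      have hit : i ∈ t := (mem_filter.1 ht).2
      rw [← insert_erase his, ← insert_erase hit]
      exact congrArg (insert i) hst
    have hsub : (Ω.filter (fun s => i ∈ s)).image (fun s => s.erase i) ⊆
        Ω.filter (fun s => Disjoint s C) := by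
      intro t ht
      obtain ⟨s, hs, rfl⟩ := mem_image.1 ht
      obtain ⟨hs, his⟩ := mem_filter.1 hs
      refine mem_filter.2 ⟨(hΩ _).2 fun a ha b hb =>
        (hΩ s).1 hs a (mem_of_mem_erase ha) b (mem_of_mem_erase hb), disjoint_left.2 ?_⟩
      intro j hj hjC
      obtain ⟨hji, hjs⟩ := mem_erase.1 hj
      exact (hΩ s).1 hs j hjs i his hji (hC j hjC i hiC hji)
    calc θ i = σ i * ∑ s ∈ Ω with i ∈ s, π (s.erase i) := by
          rw [hθ, mul_sum]
          refine sum_congr rfl fun s hs => ?_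
          rw [hπ, hπ, ← mul_prod_erase s σ (mem_filter.1 hs).2, mul_div_assoc]
      _ = σ i * ∑ s ∈ (Ω.filter (fun s => i ∈ s)).image (fun s => s.erase i), π s := by
          rw [sum_image hinj]
      _ ≤ σ i * ∑ s ∈ Ω with Disjoint s C, π s :=
          mul_le_mul_of_nonneg_left
            (sum_le_sum_of_subset_of_nonneg hsub fun s _ _ => hπ0 s) (hσ i).le
  rw [← add_sum_erase C θ hiC] at hpartition
  have hvacant : ∑ s ∈ Ω with Disjoint s C, π s = 1 - ∑ j ∈ C.erase i, θ j - θ i := by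
    linarith
  rw [hvacant] at hflip
  have hi := hσ i
  rw [div_mul_eq_mul_div, le_div_iff₀ (by linarith)]
  linarith
end

section
/- For every k = 1, ..., K: Q(N_k) = Q(Ω∖N_k) = π(0) Σ_{i∈V_k} σ_i, and under the stated load and stability assumptions, Q(N_k) < M_k (1 − Σ_{l≠k} ρ̂_l) ((1−ρ)/ρ̂_k)^{M_k − 1}. (This is equation (14) of Lemma 2.) -/
open Finset

/-- A nonempty state is feasible with a node active in component `k` iff it lies inside `k`. -/
theorem mem_and_exists_color_iff {V : Type*} {K : ℕ} {c : V → Fin K} {Ω : Finset (Finset V)}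
    (hΩ : ∀ s, s ∈ Ω ↔ ∀ i ∈ s, ∀ j ∈ s, c i = c j)
    (k : Fin K) (s : Finset V) :
    (s ∈ Ω ∧ ∃ i ∈ s, c i = k) ↔ s ≠ ∅ ∧ ∀ i ∈ s, c i = k := by
  rw [hΩ]
  constructor
  · rintro ⟨h, i, hi, rfl⟩
    exact ⟨ne_empty_of_mem hi, fun j hj => h j hj i hi⟩
  · rintro ⟨hne, h⟩
    obtain ⟨i, hi⟩ := nonempty_iff_ne_empty.2 hne
    exact ⟨fun a ha b hb => (h a ha).trans (h b hb).symm, i, hi, h i hi⟩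

theorem sum_prod_powerset_erase_empty {V : Type*} [DecidableEq V] (σ : V → ℝ)
    (C : Finset V) :
    ∑ s ∈ C.powerset.erase ∅, ∏ i ∈ s, σ i = ∏ i ∈ C, (1 + σ i) - 1 := by
  rw [prod_one_add, ← add_sum_erase C.powerset _ (empty_mem_powerset C)]
  simp

/-- The partition function of the complete partite graph. -/
theorem sum_prod_feasible {V : Type*} [Fintype V] [DecidableEq V] {K : ℕ} {c : V → Fin K}
    {Ω : Finset (Finset V)} (hΩ : ∀ s, s ∈ Ω ↔ ∀ i ∈ s, ∀ j ∈ s, c i = c j) (σ : V → ℝ) :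
    ∑ s ∈ Ω, ∏ i ∈ s, σ i = 1 + ∑ k, (∏ i with c i = k, (1 + σ i) - 1) := by
  have hmem : ∅ ∈ Ω := by simp [hΩ]
  have hU : Ω.erase ∅ = univ.biUnion fun k => (univ.filter (c · = k)).powerset.erase ∅ := by
    ext s
    simp only [mem_erase, mem_biUnion, mem_univ, true_and, mem_powerset, subset_iff, mem_filter]
    constructor
    · rintro ⟨hne, hs⟩
      obtain ⟨i, hi⟩ := nonempty_iff_ne_empty.2 hne
      exact ⟨c i, hne, fun j hj => (hΩ s).1 hs j hj i hi⟩
    · rintro ⟨k, hne, h⟩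
      exact ⟨hne, ((mem_and_exists_color_iff hΩ k s).2 ⟨hne, fun i hi => h hi⟩).1⟩
  rw [← add_sum_erase Ω _ hmem, hU, sum_biUnion]
  · simp only [sum_prod_powerset_erase_empty, prod_empty]
  · intro k _ l _ hkl
    rw [Function.onFun, disjoint_left]
    intro s hs ht
    simp only [mem_erase, mem_powerset, subset_iff, mem_filter, mem_univ, true_and] at hs ht
    obtain ⟨i, hi⟩ := nonempty_iff_ne_empty.2 hs.1
    exact hkl ((hs.2 hi).symm.trans (ht.2 hi))

theorem filter_mem_feasible {V : Type*} [Fintype V] [DecidableEq V] {K : ℕ} {c : V → Fin K}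
    {Ω : Finset (Finset V)} (hΩ : ∀ s, s ∈ Ω ↔ ∀ i ∈ s, ∀ j ∈ s, c i = c j) (i : V) :
    Ω.filter (i ∈ ·) = (univ.filter (c · = c i)).powerset.filter (i ∈ ·) := by
  ext s
  simp only [mem_filter, mem_powerset, subset_iff, mem_univ, true_and, hΩ]
  exact ⟨fun h => ⟨fun j hj => h.1 j hj i h.2, h.2⟩,
    fun h => ⟨fun a ha b hb => (h.1 ha).trans (h.1 hb).symm, h.2⟩⟩

theorem one_add_mul_sum_prod_powerset_filter_mem {V : Type*} [DecidableEq V] (σ : V → ℝ)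
    {C : Finset V} {i : V}
    (hi : i ∈ C) :
    (1 + σ i) * ∑ s ∈ C.powerset.filter (i ∈ ·), ∏ j ∈ s, σ j = σ i * ∏ j ∈ C, (1 + σ j) := by
  have himg : C.powerset.filter (i ∈ ·) = (C.erase i).powerset.image (insert i) := by
    ext s
    simp only [mem_filter, mem_powerset, mem_image]
    constructor
    · rintro ⟨hs, his⟩
      exact ⟨s.erase i, erase_subset_erase _ hs, insert_erase his⟩
    · rintro ⟨t, ht, rfl⟩
      exact ⟨insert_subset hi (ht.trans (erase_subset _ _)), mem_insert_self _ _⟩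
  have hnot : ∀ t ∈ (C.erase i).powerset, i ∉ t := fun t ht hit =>
    notMem_erase i C (mem_powerset.1 ht hit)
  rw [himg, sum_image, sum_congr rfl fun t ht => prod_insert (hnot t ht), ← mul_sum,
    ← prod_one_add, ← mul_prod_erase C _ hi]
  · ring
  · intro s hs t ht hst
    rw [← erase_insert (hnot s hs), hst, erase_insert (hnot t ht)]

theorem sum_prod_powerset_filter_mem_le {V : Type*} [DecidableEq V] {σ : V → ℝ}
    (hσ : ∀ i, 0 < σ i) (C : Finset V) (i : V) :
    ∑ s ∈ C.powerset.filter (i ∈ ·), ∏ j ∈ s, σ j ≤ ∏ j ∈ C, (1 + σ j) - 1 := by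
  rw [← sum_prod_powerset_erase_empty]
  refine sum_le_sum_of_subset_of_nonneg (fun s hs => ?_)
    fun s _ _ => prod_nonneg fun j _ => (hσ j).le
  rw [mem_filter] at hs
  exact mem_erase.2 ⟨ne_empty_of_mem hs.2, hs.1⟩

/-- Summing over two families of states a flow supported on the pairs `({i}, ∅)`, `i ∈ C`,
collects the weights `g` over `C`. -/
theorem sum_sum_indicator_singleton_empty {V : Type*} [DecidableEq V] {N B : Finset (Finset V)}
    {C : Finset V}
    (hN : ∀ i ∈ C, {i} ∈ N) (hB : ∅ ∈ B) (f : Finset V → Finset V → ℝ) (g : V → ℝ)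
    (hf : ∀ u ∈ N, ∀ v ∈ B, f u v = ∑ i ∈ C, if u = {i} ∧ v = ∅ then g i else 0) :
    ∑ u ∈ N, ∑ v ∈ B, f u v = ∑ i ∈ C, g i := by
  rw [sum_congr rfl fun u hu => sum_congr rfl fun v hv => hf u hu v hv]
  simp_rw [sum_comm (s := B)]
  rw [sum_comm]
  refine sum_congr rfl fun i hi => ?_
  simp [ite_and, hN i hi, hB]

/-- Numerical core of the flow bound for one component `C` with load `r`. -/
theorem mul_sum_lt_of_load_lt {V : Type*} [DecidableEq V] {σ : V → ℝ} (hσ : ∀ i, 0 < σ i)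
    {C : Finset V}
    (hC : C.Nonempty) {p a r : ℝ} (hp : 0 < p) (hr : 0 < r)
    (ha : p * ∏ j ∈ C, (1 + σ j) ≤ a)
    (hload : ∀ i ∈ C, r * (1 + σ i) < p * (σ i * ∏ j ∈ C, (1 + σ j))) :
    p * ∑ i ∈ C, σ i < C.card * a * ((a - r) / r) ^ (C.card - 1) := by
  have hP : 0 < ∏ j ∈ C, (1 + σ j) := prod_pos fun j _ => by linarith [hσ j]
  have ha0 : 0 < a := (mul_pos hp hP).trans_le ha
  have key : ∀ i ∈ C, r * (1 + σ i) < a * σ i := fun i hi => by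
    have := mul_le_mul_of_nonneg_right ha (hσ i).le
    linarith [hload i hi]
  have hra : r < a := by
    obtain ⟨i, hi⟩ := hC
    have h := hσ i
    have := key i hi
    nlinarith
  set t := (a - r) / r with ht
  have ht0 : 0 < t := div_pos (sub_pos.2 hra) hr
  have hone : ∀ i ∈ C, 1 ≤ t * (1 + σ i) := fun i hi => by
    rw [ht, div_mul_eq_mul_div, le_div_iff₀ hr]
    linarith [key i hi]
  have hterm : ∀ i ∈ C, p * σ i < a * t ^ (C.card - 1) := fun i hi => by
    have hprod : 1 ≤ t ^ (C.card - 1) * ∏ j ∈ C.erase i, (1 + σ j) := by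
      rw [← card_erase_of_mem hi, ← prod_const, ← prod_mul_distrib]
      exact one_le_prod fun j hj => hone j (mem_of_mem_erase hj)
    rw [← mul_prod_erase C _ hi] at ha
    calc p * σ i < p * (1 + σ i) := by linarith
      _ ≤ p * (1 + σ i) * (t ^ (C.card - 1) * ∏ j ∈ C.erase i, (1 + σ j)) :=
        le_mul_of_one_le_right (mul_nonneg hp.le (by linarith [hσ i])) hprod
      _ = p * ((1 + σ i) * ∏ j ∈ C.erase i, (1 + σ j)) * t ^ (C.card - 1) := by ring
      _ ≤ a * t ^ (C.card - 1) := mul_le_mul_of_nonneg_right ha (pow_pos ht0 _).le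
  rw [mul_sum]
  calc ∑ i ∈ C, p * σ i < ∑ i ∈ C, a * t ^ (C.card - 1) := sum_lt_sum_of_nonempty hC hterm
    _ = _ := by rw [sum_const, nsmul_eq_mul, mul_assoc]

/-- (Equation (14) of Lemma 2.) For the complete `K`-partite interference
graph with activation rates `σ_i` and unit de-activation rates, for every `k`:
`Q(N_k) = Q(Ω∖N_k) = π(0) Σ_{i∈V_k} σ_i`, and under the load and stability assumptions,
`Q(N_k) < M_k (1 − Σ_{l≠k} ρ̂_l) ((1−ρ)/ρ̂_k)^{M_k−1}`. -/
theorem complete_partite_bottleneck_flow_bound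
    {V : Type*} [Fintype V] [DecidableEq V] {K : ℕ} (G : SimpleGraph V)
    (c : V → Fin K) (hcsurj : Function.Surjective c)
    (hG : ∀ i j : V, G.Adj i j ↔ c i ≠ c j)
    (σ : V → ℝ) (hσ : ∀ i, 0 < σ i)
    (Ω : Finset (Finset V))
    (hΩ : ∀ s : Finset V, s ∈ Ω ↔ ∀ i ∈ s, ∀ j ∈ s, i ≠ j → ¬ G.Adj i j)
    (Z : ℝ) (hZ : Z = ∑ s ∈ Ω, ∏ i ∈ s, σ i)
    (π : Finset V → ℝ) (hπ : ∀ s, π s = (∏ i ∈ s, σ i) / Z)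
    (θ : V → ℝ) (hθ : ∀ i, θ i = ∑ s ∈ Ω.filter (fun s => i ∈ s), π s)
    (q : Finset V → Finset V → ℝ)
    (hq : ∀ u v : Finset V, u ∈ Ω → v ∈ Ω → u ≠ v →
      q u v = (∑ i : V, if i ∉ u ∧ v = insert i u then σ i else 0)
            + (∑ i : V, if i ∈ u ∧ v = u.erase i then 1 else 0))
    (hq0 : ∀ u v : Finset V, u ∉ Ω ∨ v ∉ Ω → q u v = 0)
    (Q : Finset (Finset V) → ℝ)
    (hQ : ∀ B : Finset (Finset V), Q B = ∑ u ∈ B, ∑ u' ∈ Ω \ B, π u * q u u')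
    (Nk : Fin K → Finset (Finset V))
    (hNk : ∀ k, Nk k = Ω.filter (fun s => ∃ i ∈ s, c i = k))
    (M : Fin K → ℕ) (hM : ∀ k, M k = (univ.filter (fun i => c i = k)).card)
    (ρhat : Fin K → ℝ) (hρhatpos : ∀ k, 0 < ρhat k)
    (ρ : ℝ) (hρ : ρ = ∑ k : Fin K, ρhat k)
    (hstab : ∀ i : V, ρhat (c i) < θ i)
    (k : Fin K) :
    Q (Nk k) = Q (Ω \ Nk k) ∧
    Q (Nk k) = π ∅ * ∑ i ∈ univ.filter (fun i => c i = k), σ i ∧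
    Q (Nk k) < (M k : ℝ) * (1 - ∑ l ∈ univ.erase k, ρhat l) *
        ((1 - ρ) / ρhat k) ^ (M k - 1) := by
  have hΩ' : ∀ s, s ∈ Ω ↔ ∀ i ∈ s, ∀ j ∈ s, c i = c j := fun s => by
    rw [hΩ]
    refine forall₄_congr fun i _ j _ => ?_
    rw [hG, not_not]
    exact ⟨fun h => (eq_or_ne i j).elim (congrArg c) h, fun h _ => h⟩
  have hmemN : ∀ s, s ∈ Nk k ↔ s ≠ ∅ ∧ ∀ i ∈ s, c i = k := fun s => by
    rw [hNk, mem_filter, mem_and_exists_color_iff hΩ']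
  have hNΩ : Nk k ⊆ Ω := hNk k ▸ filter_subset _ _
  have hmemB : ∀ s ∈ Ω \ Nk k, ∀ i ∈ s, c i ≠ k := fun s hs i hi hik => by
    rw [mem_sdiff, hNk, mem_filter] at hs
    exact hs.2 ⟨hs.1, i, hi, hik⟩
  have hB : ∅ ∈ Ω \ Nk k := by simp [hΩ', hmemN]
  set C := univ.filter (fun i => c i = k) with hCdef
  have hmemC : ∀ i, i ∈ C ↔ c i = k := fun i => by simp [C]
  have hN : ∀ i ∈ C, {i} ∈ Nk k := fun i hi => by simpa [hmemN] using (hmemC i).1 hi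
  have herase : ∀ u ∈ Nk k, ∀ v ∈ Ω \ Nk k, ∀ i,
      (i ∈ u ∧ v = u.erase i) ↔ (i ∈ C ∧ u = {i} ∧ v = ∅) := by
    intro u hu v hv i
    constructor
    · rintro ⟨hi, rfl⟩
      have hu' := ((hmemN u).1 hu).2
      have he : u.erase i = ∅ := eq_empty_of_forall_notMem fun j hj =>
        hmemB _ hv j hj (hu' j (mem_of_mem_erase hj))
      refine ⟨(hmemC i).2 (hu' i hi), ?_, he⟩
      rw [← insert_erase hi, he, insert_empty_eq]
    · rintro ⟨_, rfl, rfl⟩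
      simp
  have hinsert : ∀ u ∈ Nk k, ∀ v ∈ Ω \ Nk k, ∀ i, v ≠ insert i u := by
    rintro u hu v hv i rfl
    obtain ⟨hne, hu'⟩ := (hmemN u).1 hu
    obtain ⟨j, hj⟩ := nonempty_iff_ne_empty.2 hne
    exact hmemB _ hv j (mem_insert_of_mem hj) (hu' j hj)
  have hne : ∀ u ∈ Nk k, ∀ v ∈ Ω \ Nk k, u ≠ v := by
    rintro u hu v hv rfl
    exact (mem_sdiff.1 hv).2 hu
  have hindicator : ∀ (u v : Finset V) (g : V → ℝ),
      (∑ i, if i ∈ C ∧ u = {i} ∧ v = ∅ then g i else 0) =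
        ∑ i ∈ C, if u = {i} ∧ v = ∅ then g i else 0 := fun u v g => by
    simp_rw [ite_and (_ ∈ C)]
    rw [sum_ite_mem, univ_inter]
  have hout : ∀ u ∈ Nk k, ∀ v ∈ Ω \ Nk k,
      q u v = ∑ i ∈ C, if u = {i} ∧ v = ∅ then (1 : ℝ) else 0 := by
    intro u hu v hv
    rw [hq u v (hNΩ hu) (mem_sdiff.1 hv).1 (hne u hu v hv), ← hindicator]
    simp [hinsert u hu v hv, herase u hu v hv]
  have hin : ∀ u ∈ Nk k, ∀ v ∈ Ω \ Nk k,
      q v u = ∑ i ∈ C, if u = {i} ∧ v = ∅ then σ i else 0 := by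
    intro u hu v hv
    have h1 : ∀ i, (i ∉ v ∧ u = insert i v) ↔ (i ∈ C ∧ u = {i} ∧ v = ∅) := fun i => by
      rw [← herase u hu v hv i]
      constructor
      · rintro ⟨hi, rfl⟩
        exact ⟨mem_insert_self _ _, (erase_insert hi).symm⟩
      · rintro ⟨hi, rfl⟩
        exact ⟨notMem_erase _ _, (insert_erase hi).symm⟩
    have h2 : ∀ i, ¬ (i ∈ v ∧ u = v.erase i) := by
      rintro i ⟨hi, rfl⟩
      exact hinsert _ hu v hv i (insert_erase hi).symm
    rw [hq v u (mem_sdiff.1 hv).1 (hNΩ hu) (hne u hu v hv).symm, ← hindicator]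
    simp only [h1, h2, if_false, sum_const_zero, add_zero]
  have hπ1 : ∀ i, π {i} = π ∅ * σ i := fun i => by
    rw [hπ, hπ, prod_singleton, prod_empty]
    ring
  have hQout : Q (Nk k) = π ∅ * ∑ i ∈ C, σ i := by
    rw [hQ, mul_sum]
    refine sum_sum_indicator_singleton_empty hN hB _ (fun i => π ∅ * σ i) fun u hu v hv => ?_
    rw [hout u hu v hv, mul_sum]
    refine sum_congr rfl fun i _ => ?_
    split_ifs with h
    · rw [h.1, hπ1, mul_one]
    · rw [mul_zero]
  have hQin : Q (Ω \ Nk k) = π ∅ * ∑ i ∈ C, σ i := by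
    rw [hQ, Finset.sdiff_sdiff_eq_self hNΩ, mul_sum, sum_comm]
    refine sum_sum_indicator_singleton_empty hN hB _ (fun i => π ∅ * σ i) fun u hu v hv => ?_
    rw [hin u hu v hv, mul_sum]
    refine sum_congr rfl fun i _ => ?_
    split_ifs with h
    · rw [h.2]
    · rw [mul_zero]
  refine ⟨hQout.trans hQin.symm, hQout, ?_⟩
  have hΥ : ∀ l, 0 ≤ ∏ i with c i = l, (1 + σ i) - 1 := fun l =>
    sub_nonneg.2 (one_le_prod fun i _ => by linarith [hσ i])
  have hZ' : Z = 1 + ∑ l, (∏ i with c i = l, (1 + σ i) - 1) := by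
    rw [hZ, sum_prod_feasible hΩ']
  have hZ0 : 0 < Z := by
    rw [hZ']
    linarith [sum_nonneg fun l (_ : l ∈ univ) => hΥ l]
  have hθ' : ∀ i, θ i =
      (∑ s ∈ (univ.filter (c · = c i)).powerset.filter (i ∈ ·), ∏ j ∈ s, σ j) / Z := fun i => by
    simp only [hθ, hπ]
    rw [← sum_div, filter_mem_feasible hΩ']
  have hπ0 : π ∅ = 1 / Z := by rw [hπ, prod_empty]
  have hρlt : ∀ l, ρhat l * Z ≤ ∏ i with c i = l, (1 + σ i) - 1 := fun l => by
    obtain ⟨i, rfl⟩ := hcsurj l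
    have h := hstab i
    rw [hθ', lt_div_iff₀ hZ0] at h
    exact h.le.trans (sum_prod_powerset_filter_mem_le hσ _ i)
  obtain ⟨i₀, hi₀⟩ := hcsurj k
  have hbound : π ∅ * ∏ j ∈ C, (1 + σ j) ≤ 1 - ∑ l ∈ univ.erase k, ρhat l := by
    rw [hπ0, one_div, inv_mul_le_iff₀ hZ0, mul_sub, mul_one, mul_comm Z, sum_mul]
    have hsum := sum_le_sum fun l (_ : l ∈ univ.erase k) => hρlt l
    rw [← add_sum_erase univ _ (mem_univ k)] at hZ'
    linarith
  have hload : ∀ i ∈ C, ρhat k * (1 + σ i) < π ∅ * (σ i * ∏ j ∈ C, (1 + σ j)) := fun i hi => by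
    have h := hstab i
    have hik := (hmemC i).1 hi
    rw [hθ', hik] at h
    rw [← one_add_mul_sum_prod_powerset_filter_mem σ hi, hπ0]
    calc ρhat k * (1 + σ i) < _ / Z * (1 + σ i) :=
          mul_lt_mul_of_pos_right h (by linarith [hσ i])
      _ = _ := by ring
  have hρ' : 1 - ρ = (1 - ∑ l ∈ univ.erase k, ρhat l) - ρhat k := by
    rw [hρ, ← add_sum_erase univ _ (mem_univ k)]
    ring
  rw [hQout, hM, hρ']
  exact mul_sum_lt_of_load_lt hσ ⟨i₀, (hmemC i₀).2 hi₀⟩ (hπ0 ▸ one_div_pos.2 hZ0)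
    (hρhatpos k) hbound hload
end

section
/- Under the stated load and stability assumptions, for every k = 1, ..., K: ρ̂_k < π(N_k) < 1 − Σ_{l≠k} ρ̂_l, and Σ_{l≠k} ρ̂_l < π(Ω∖N_k) < 1 − ρ̂_k. (These are equations (15) and (16) of Lemma 2.) -/
open Finset

/-- (Equations (15) and (16) of Lemma 2.) For the complete `K`-partite
interference graph, under the load and stability assumptions, for every `k`:
`ρ̂_k < π(N_k) < 1 − Σ_{l≠k} ρ̂_l` and `Σ_{l≠k} ρ̂_l < π(Ω∖N_k) < 1 − ρ̂_k`. -/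
theorem complete_partite_pi_Nk_bounds
    {V : Type*} [Fintype V] [DecidableEq V] {K : ℕ} (G : SimpleGraph V)
    (c : V → Fin K) (hcsurj : Function.Surjective c)
    (hG : ∀ i j : V, G.Adj i j ↔ c i ≠ c j)
    (σ : V → ℝ) (hσ : ∀ i, 0 < σ i)
    (Ω : Finset (Finset V))
    (hΩ : ∀ s : Finset V, s ∈ Ω ↔ ∀ i ∈ s, ∀ j ∈ s, i ≠ j → ¬ G.Adj i j)
    (Z : ℝ) (hZ : Z = ∑ s ∈ Ω, ∏ i ∈ s, σ i)
    (π : Finset V → ℝ) (hπ : ∀ s, π s = (∏ i ∈ s, σ i) / Z)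
    (θ : V → ℝ) (hθ : ∀ i, θ i = ∑ s ∈ Ω.filter (fun s => i ∈ s), π s)
    (Nk : Fin K → Finset (Finset V))
    (hNk : ∀ k, Nk k = Ω.filter (fun s => ∃ i ∈ s, c i = k))
    (ρhat : Fin K → ℝ) (hρhatpos : ∀ k, 0 < ρhat k)
    (ρ : ℝ) (hρ : ρ = ∑ k : Fin K, ρhat k)
    (hstab : ∀ i : V, ρhat (c i) < θ i)
    (k : Fin K) :
    (ρhat k < ∑ u ∈ Nk k, π u ∧ ∑ u ∈ Nk k, π u < 1 - ∑ l ∈ univ.erase k, ρhat l) ∧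
    (∑ l ∈ univ.erase k, ρhat l < ∑ u ∈ Ω \ Nk k, π u ∧
      ∑ u ∈ Ω \ Nk k, π u < 1 - ρhat k) := by
  have hw : ∀ s : Finset V, 0 < ∏ i ∈ s, σ i := fun s => prod_pos fun i _ => hσ i
  have hempty : ∅ ∈ Ω := (hΩ ∅).2 (by simp)
  have hZpos : 0 < Z := hZ ▸ sum_pos (fun s _ => hw s) ⟨∅, hempty⟩
  have hπpos : ∀ s, 0 < π s := fun s => hπ s ▸ div_pos (hw s) hZpos
  have htotal : ∑ s ∈ Ω, π s = 1 := by
    simp_rw [hπ]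
    rw [← sum_div, ← hZ, div_self hZpos.ne']
  have hlower : ∀ l, ρhat l < ∑ u ∈ Nk l, π u := by
    intro l
    obtain ⟨i, rfl⟩ := hcsurj l
    refine (hstab i).trans_le ?_
    rw [hθ, hNk]
    refine sum_le_sum_of_subset_of_nonneg (fun s hs => ?_) fun s _ _ => (hπpos s).le
    rw [mem_filter] at hs ⊢
    exact ⟨hs.1, i, hs.2, rfl⟩
  have hdisj : ∀ l m, l ≠ m → Disjoint (Nk l) (Nk m) := by
    intro l m hlm
    rw [disjoint_left]
    intro s hl hm
    rw [hNk, mem_filter] at hl hm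
    obtain ⟨hs, i, hi, hil⟩ := hl
    obtain ⟨-, j, hj, hjm⟩ := hm
    have hc : c i ≠ c j := by rwa [hil, hjm]
    exact (hΩ s).1 hs i hi j hj (fun h => hc (congrArg c h)) ((hG i j).2 hc)
  have hsum : ∑ l, ∑ u ∈ Nk l, π u < 1 := by
    rw [← sum_biUnion fun l _ m _ hlm => hdisj l m hlm, ← htotal]
    refine sum_lt_sum_of_subset (i := ∅) ?_ hempty ?_ (hπpos _) fun s _ _ => (hπpos s).le
    · intro s hs
      obtain ⟨l, -, hl⟩ := mem_biUnion.1 hs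
      rw [hNk] at hl
      exact (mem_filter.1 hl).1
    · simp [hNk]
  have hcompl : ∑ u ∈ Ω \ Nk k, π u + ∑ u ∈ Nk k, π u = 1 := by
    rw [← htotal]
    exact sum_sdiff (hNk k ▸ filter_subset _ _)
  have hsplit := add_sum_erase univ (fun l => ∑ u ∈ Nk l, π u) (mem_univ k)
  have hothers : ∑ l ∈ univ.erase k, ρhat l ≤ ∑ l ∈ univ.erase k, ∑ u ∈ Nk l, π u :=
    sum_le_sum fun l _ => (hlower l).le
  have hk := hlower k
  refine ⟨⟨hk, ?_⟩, ?_, ?_⟩ <;> linarith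
end

section
/- Under the stated load and stability assumptions, for every k = 1, ..., K, the inverse bottleneck ratio of N_k satisfies π(N_k)/Q(N_k) > ( ρ̂_k / (M_k (1 − Σ_{l≠k} ρ̂_l)) ) · ( ρ̂_k/(1−ρ) )^{M_k − 1}. (This lower bound on the expected return time 1/Φ(N_k) underlies the delay and mixing-time lower bounds of Theorems 2 and 3 for complete partite graphs.) -/
open Finset

/-- If every `x i` is at least `t ≥ 0`, the nonempty subsets of `s` carry at least the weight
`t ^ (#s - 1)` times the average weight of a singleton. -/
lemma sum_mul_pow_le_card_mul_prod_one_add_sub_one {ι : Type*} [DecidableEq ι]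
    (s : Finset ι) (x : ι → ℝ) {t : ℝ} (ht : 0 ≤ t) (hx : ∀ i ∈ s, t ≤ x i) :
    (∑ i ∈ s, x i) * t ^ (#s - 1) ≤ #s * (∏ i ∈ s, (1 + x i) - 1) := by
  rw [sum_mul, ← nsmul_eq_mul]
  refine sum_le_card_nsmul _ _ _ fun i hi => ?_
  have hpow : t ^ (#s - 1) ≤ ∏ j ∈ s.erase i, (1 + x j) := by
    rw [← card_erase_of_mem hi, ← prod_const]
    exact prod_le_prod (fun _ _ => ht) fun j hj => by linarith [hx j (mem_of_mem_erase hj)]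
  have hone : 1 ≤ ∏ j ∈ s.erase i, (1 + x j) :=
    prod_const_one.symm.trans_le <| prod_le_prod (fun _ _ => zero_le_one)
      fun j hj => by linarith [hx j (mem_of_mem_erase hj)]
  rw [← mul_prod_erase s (fun j => 1 + x j) hi]
  nlinarith [mul_le_mul_of_nonneg_left hpow (ht.trans (hx i hi))]

/-- The subsets of `s` containing `i` carry the fraction `x i / (1 + x i)` of the total weight. -/
lemma one_add_mul_sum_powerset_filter_mem {ι : Type*} [DecidableEq ι]
    (s : Finset ι) (x : ι → ℝ) {i : ι} (hi : i ∈ s) :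
    (1 + x i) * ∑ t ∈ s.powerset with i ∈ t, ∏ j ∈ t, x j = x i * ∏ j ∈ s, (1 + x j) := by
  have hmem : ∀ t ∈ (s.erase i).powerset, i ∉ t := fun t ht hit =>
    notMem_erase i s (mem_powerset.1 ht hit)
  have hsum : ∑ t ∈ s.powerset with i ∈ t, ∏ j ∈ t, x j
      = x i * ∏ j ∈ s.erase i, (1 + x j) := by
    conv_lhs => rw [← insert_erase hi]
    rw [sum_filter, sum_powerset_insert (notMem_erase i s), prod_one_add, mul_sum,
      sum_eq_zero fun t ht => if_neg (hmem t ht), zero_add]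
    refine sum_congr rfl fun t ht => ?_
    rw [if_pos (mem_insert_self i t), prod_insert (hmem t ht)]
  rw [hsum, ← mul_prod_erase s (fun j => 1 + x j) hi]
  ring

/-- For the complete `K`-partite interference graph, under the load and
stability assumptions, the inverse bottleneck ratio of `N_k` satisfies
`π(N_k)/Q(N_k) > (ρ̂_k/(M_k(1 − Σ_{l≠k} ρ̂_l))) (ρ̂_k/(1−ρ))^{M_k−1}` for every `k`. -/
theorem complete_partite_return_time_lower_bound
    {V : Type*} [Fintype V] [DecidableEq V] {K : ℕ} (G : SimpleGraph V)
    (c : V → Fin K) (hcsurj : Function.Surjective c)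
    (hG : ∀ i j : V, G.Adj i j ↔ c i ≠ c j)
    (σ : V → ℝ) (hσ : ∀ i, 0 < σ i)
    (Ω : Finset (Finset V))
    (hΩ : ∀ s : Finset V, s ∈ Ω ↔ ∀ i ∈ s, ∀ j ∈ s, i ≠ j → ¬ G.Adj i j)
    (Z : ℝ) (hZ : Z = ∑ s ∈ Ω, ∏ i ∈ s, σ i)
    (π : Finset V → ℝ) (hπ : ∀ s, π s = (∏ i ∈ s, σ i) / Z)
    (θ : V → ℝ) (hθ : ∀ i, θ i = ∑ s ∈ Ω.filter (fun s => i ∈ s), π s)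
    (q : Finset V → Finset V → ℝ)
    (hq : ∀ u v : Finset V, u ∈ Ω → v ∈ Ω → u ≠ v →
      q u v = (∑ i : V, if i ∉ u ∧ v = insert i u then σ i else 0)
            + (∑ i : V, if i ∈ u ∧ v = u.erase i then 1 else 0))
    (hq0 : ∀ u v : Finset V, u ∉ Ω ∨ v ∉ Ω → q u v = 0)
    (Q : Finset (Finset V) → ℝ)
    (hQ : ∀ B : Finset (Finset V), Q B = ∑ u ∈ B, ∑ u' ∈ Ω \ B, π u * q u u')
    (Nk : Fin K → Finset (Finset V))
    (hNk : ∀ k, Nk k = Ω.filter (fun s => ∃ i ∈ s, c i = k))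
    (M : Fin K → ℕ) (hM : ∀ k, M k = (univ.filter (fun i => c i = k)).card)
    (ρhat : Fin K → ℝ) (hρhatpos : ∀ k, 0 < ρhat k)
    (ρ : ℝ) (hρ : ρ = ∑ k : Fin K, ρhat k)
    (hstab : ∀ i : V, ρhat (c i) < θ i)
    (k : Fin K) :
    (∑ u ∈ Nk k, π u) / Q (Nk k) >
      (ρhat k / ((M k : ℝ) * (1 - ∑ l ∈ univ.erase k, ρhat l))) *
        (ρhat k / (1 - ρ)) ^ (M k - 1) := by
  have hind : ∀ s, s ∈ Ω ↔ ∀ i ∈ s, ∀ j ∈ s, c i = c j := by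
    intro s
    simp only [hΩ, hG, not_not]
    refine ⟨fun h i hi j hj => ?_, fun h i hi j hj _ => h i hi j hj⟩
    by_cases hij : i = j
    · rw [hij]
    · exact h i hi j hj hij
  set W : Fin K → Finset V := fun l => univ.filter (fun i => c i = l) with hW
  set P : Fin K → ℝ := fun l => ∏ i ∈ W l, (1 + σ i) with hP
  have hmemW : ∀ i l, i ∈ W l ↔ c i = l := fun i l => by simp [hW]
  have hempty : ∅ ∈ Ω := by simp [hΩ]
  have hmemN : ∀ l s, s ∈ Nk l ↔ s ⊆ W l ∧ s.Nonempty := by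
    intro l s
    rw [hNk, mem_filter, hind]
    constructor
    · rintro ⟨h, i, hi, rfl⟩
      exact ⟨fun j hj => (hmemW _ _).2 (h j hj i hi), i, hi⟩
    · rintro ⟨h, i, hi⟩
      have hc : ∀ j ∈ s, c j = l := fun j hj => (hmemW j l).1 (h hj)
      exact ⟨fun a ha b hb => (hc a ha).trans (hc b hb).symm, i, hi, hc i hi⟩
  have hNsub : ∀ l, Nk l ⊆ Ω := fun l => by rw [hNk]; exact filter_subset _ _
  have hZpos : 0 < Z := by
    rw [hZ]
    exact sum_pos (fun s _ => prod_pos fun i _ => hσ i) ⟨∅, hempty⟩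
  have hπpos : ∀ s, 0 < π s := fun s => by
    rw [hπ]; exact div_pos (prod_pos fun i _ => hσ i) hZpos
  have hN : ∀ l, ∑ u ∈ Nk l, π u = (P l - 1) / Z := by
    intro l
    have hNl : Nk l = (W l).powerset.erase ∅ := by
      ext s; rw [hmemN, mem_erase, mem_powerset, nonempty_iff_ne_empty, and_comm]
    simp only [hπ, ← sum_div, hNl, hP]
    rw [prod_one_add, ← add_sum_erase _ _ (empty_mem_powerset (W l)), prod_empty,
      add_sub_cancel_left]
  have hθeq : ∀ i, (1 + σ i) * θ i = σ i * (P (c i) / Z) := by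
    intro i
    have hf : Ω.filter (fun s => i ∈ s) = (W (c i)).powerset.filter (fun s => i ∈ s) := by
      ext s
      simp only [mem_filter, mem_powerset, and_congr_left_iff, hind]
      intro hi
      refine ⟨fun h j hj => (hmemW _ _).2 (h j hj i hi), fun h a ha b hb => ?_⟩
      exact ((hmemW _ _).1 (h ha)).trans ((hmemW _ _).1 (h hb)).symm
    simp only [hθ, hf, hπ, ← sum_div]
    rw [← mul_div_assoc, one_add_mul_sum_powerset_filter_mem _ _ ((hmemW _ _).2 rfl),
      mul_div_assoc]
  have hθN : ∀ i, θ i ≤ (P (c i) - 1) / Z := by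
    intro i
    rw [← hN, hθ, hNk]
    refine sum_le_sum_of_subset_of_nonneg (fun s hs => ?_) fun s _ _ => (hπpos s).le
    rw [mem_filter] at hs ⊢
    exact ⟨hs.1, i, hs.2, rfl⟩
  have htotal : ∑ l, (P l - 1) / Z + 1 / Z = 1 := by
    have hdisj : ((univ : Finset (Fin K)) : Set (Fin K)).PairwiseDisjoint Nk := by
      intro a _ b _ hab
      refine disjoint_left.2 fun s hsa hsb => hab ?_
      obtain ⟨ha, i, hi⟩ := (hmemN a s).1 hsa
      exact ((hmemW i a).1 (ha hi)).symm.trans ((hmemW i b).1 (((hmemN b s).1 hsb).1 hi))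
    have hunion : Ω.erase ∅ = univ.biUnion Nk := by
      ext s
      simp only [mem_erase, mem_biUnion, mem_univ, true_and]
      constructor
      · rintro ⟨hne, hs⟩
        obtain ⟨i, hi⟩ := nonempty_iff_ne_empty.2 hne
        exact ⟨c i, by rw [hNk, mem_filter]; exact ⟨hs, i, hi, rfl⟩⟩
      · rintro ⟨l, hl⟩
        exact ⟨nonempty_iff_ne_empty.1 ((hmemN l s).1 hl).2, hNsub l hl⟩
    have hone : ∑ s ∈ Ω, π s = 1 := by
      simp only [hπ, ← sum_div, ← hZ]
      exact div_self hZpos.ne'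
    rw [← add_sum_erase _ _ hempty, hunion, sum_biUnion hdisj, hπ, prod_empty] at hone
    simp only [hN] at hone
    linarith
  have hflow : Q (Nk k) = (∑ i ∈ W k, σ i) / Z := by
    have hrate : ∀ u ∈ Nk k, ∀ v ∈ Ω \ Nk k,
        π u * q u v = ∑ i ∈ W k, if u = {i} then (if v = ∅ then π {i} else 0) else 0 := by
      intro u hu v hv
      obtain ⟨hvΩ, hvN⟩ := mem_sdiff.1 hv
      obtain ⟨huW, hune⟩ := (hmemN k u).1 hu
      have hup : ∀ i, ¬ (i ∉ u ∧ v = insert i u) := by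
        rintro i ⟨-, rfl⟩
        obtain ⟨j, hj⟩ := hune
        apply hvN
        rw [hNk, mem_filter]
        exact ⟨hvΩ, j, mem_insert_of_mem hj, (hmemW j k).1 (huW hj)⟩
      have hdown : ∀ i, (i ∈ u ∧ v = u.erase i) ↔ (u = {i} ∧ v = ∅) := by
        intro i
        constructor
        · rintro ⟨hi, rfl⟩
          have he : u.erase i = ∅ := by
            by_contra hne
            exact hvN ((hmemN _ _).2
              ⟨(erase_subset _ _).trans huW, nonempty_iff_ne_empty.2 hne⟩)
          exact ⟨by rw [← insert_erase hi, he]; rfl, he⟩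
        · rintro ⟨rfl, rfl⟩
          simp
      rw [hq u v (hNsub k hu) hvΩ (fun h => hvN (h ▸ hu))]
      simp only [hup, hdown, if_false, sum_const_zero, zero_add, mul_sum]
      symm
      refine sum_subset_zero_on_sdiff (subset_univ _) (fun i hi => ?_) fun i _ => ?_
      · have hui : u ≠ {i} := by
          rintro rfl
          exact (mem_sdiff.1 hi).2 (huW (mem_singleton_self i))
        simp [hui]
      · by_cases hui : u = {i} <;> by_cases hv0 : v = ∅ <;> simp [hui, hv0]
    rw [hQ, sum_congr rfl fun u hu => (sum_congr rfl (hrate u hu)).trans sum_comm, sum_comm,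
      sum_div]
    refine sum_congr rfl fun i hi => ?_
    have h1 : {i} ∈ Nk k :=
      (hmemN _ _).2 ⟨singleton_subset_iff.2 hi, singleton_nonempty i⟩
    have h2 : ∅ ∈ Ω \ Nk k :=
      mem_sdiff.2 ⟨hempty, fun h => not_nonempty_empty ((hmemN _ _).1 h).2⟩
    rw [sum_comm, sum_congr rfl fun v _ => sum_ite_eq' (Nk k) {i} _]
    simp only [h1, if_true]
    rw [sum_ite_eq' _ _ _, if_pos h2, hπ, prod_singleton]
  set a : ℝ := 1 - ∑ l ∈ univ.erase k, ρhat l with ha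
  have hρa : 1 - ρ = a - ρhat k := by
    rw [hρ, ha, ← add_sum_erase _ _ (mem_univ k)]; ring
  have hPa : P k / Z ≤ a := by
    have hle : ∑ l ∈ univ.erase k, ρhat l ≤ ∑ l ∈ univ.erase k, (P l - 1) / Z := by
      refine sum_le_sum fun l _ => ?_
      obtain ⟨i, rfl⟩ := hcsurj l
      exact (hstab i).le.trans (hθN i)
    rw [← add_sum_erase _ _ (mem_univ k), sub_div] at htotal
    linarith
  have hbound : ∀ i ∈ W k, ρhat k < σ i * (a - ρhat k) := by
    intro i hi
    obtain rfl := (hmemW i k).1 hi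
    have h1 := mul_lt_mul_of_pos_left (hstab i) (by linarith [hσ i] : 0 < 1 + σ i)
    rw [hθeq] at h1
    linarith [mul_le_mul_of_nonneg_left hPa (hσ i).le]
  obtain ⟨i₀, hi₀⟩ : (W k).Nonempty := by
    obtain ⟨i, hi⟩ := hcsurj k
    exact ⟨i, (hmemW i k).2 hi⟩
  have hd : 0 < a - ρhat k :=
    pos_of_mul_pos_right ((hρhatpos k).trans (hbound i₀ hi₀)) (hσ i₀).le
  have hapos : 0 < a := by linarith [hρhatpos k]
  have ht : 0 < ρhat k / (a - ρhat k) := div_pos (hρhatpos k) hd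
  have hkey := sum_mul_pow_le_card_mul_prod_one_add_sub_one (W k) σ ht.le
    fun i hi => ((div_lt_iff₀ hd).2 (hbound i hi)).le
  have hSpos : 0 < ∑ i ∈ W k, σ i := sum_pos (fun i _ => hσ i) ⟨i₀, hi₀⟩
  have hMpos : (0 : ℝ) < #(W k) := by exact_mod_cast card_pos.2 ⟨i₀, hi₀⟩
  rw [hN, hflow, hρa, hM, div_div_div_cancel_right₀ hZpos.ne']
  calc ρhat k / (#(W k) * a) * (ρhat k / (a - ρhat k)) ^ (#(W k) - 1)
      < 1 / #(W k) * (ρhat k / (a - ρhat k)) ^ (#(W k) - 1) := by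
        refine mul_lt_mul_of_pos_right ?_ (pow_pos ht _)
        rw [div_lt_div_iff₀ (mul_pos hMpos hapos) hMpos]
        nlinarith
    _ ≤ (P k - 1) / ∑ i ∈ W k, σ i := by
        rw [le_div_iff₀ hSpos, one_div, mul_assoc, inv_mul_le_iff₀ hMpos, mul_comm (_ ^ _)]
        exact hkey
end

section
/- Let γ > 0 and assume ρ ≥ 1 − γ ζ ρ_min². Then the per-component products Π_k = ∏_{i∈V_k} σ_i satisfy min_{k=1,...,K} Π_k/ρ̂_k ≥ (1 − 3γ) max_{k=1,...,K} Π_k/ρ̂_k. (This is Lemma 4.) -/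
open Finset

/-- Summing over a fiber with weights reciprocal to the size of the fiber is averaging. -/
theorem sum_fiber_card_inv_mul {V ι : Type*} [Fintype V] [DecidableEq ι] {c : V → ι}
    (hc : Function.Surjective c) (k : ι) (a : ℝ) :
    ∑ i ∈ univ.filter (fun i => c i = k),
      ((univ.filter (fun j => c j = c i)).card : ℝ)⁻¹ * a = a := by
  obtain ⟨i, hi⟩ := hc k
  have hcard : ((univ.filter (fun j => c j = k)).card : ℝ) ≠ 0 :=
    Nat.cast_ne_zero.2 (card_ne_zero_of_mem (mem_filter.2 ⟨mem_univ i, hi⟩))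
  rw [sum_congr rfl (g := fun _ => ((univ.filter (fun j => c j = k)).card : ℝ)⁻¹ * a)
    (fun j hj => by rw [(mem_filter.1 hj).2]), sum_const, nsmul_eq_mul,
    mul_inv_cancel_left₀ hcard]

/-- A sum of fiberwise proportions is a weighted sum over the points of the set. -/
theorem sum_fiber_card_div {V ι : Type*} [Fintype ι] [DecidableEq ι] (c : V → ι)
    (m : ι → ℝ) (s : Finset V) :
    ∑ k, ((s.filter (fun i => c i = k)).card : ℝ) / m k = ∑ i ∈ s, (m (c i))⁻¹ := by
  rw [← sum_fiberwise s c]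
  refine sum_congr rfl fun k _ => ?_
  rw [sum_congr rfl (g := fun _ => (m k)⁻¹) (fun j hj => by rw [(mem_filter.1 hj).2]),
    sum_const, nsmul_eq_mul, div_eq_mul_inv]

/-- A weighted sum of marginals is the expectation of the weight of the random set. -/
theorem sum_mul_sum_filter_mem {V : Type*} [Fintype V] [DecidableEq V]
    (Ω : Finset (Finset V)) (w : V → ℝ) (p : Finset V → ℝ) :
    ∑ i, w i * ∑ s ∈ Ω.filter (fun s => i ∈ s), p s = ∑ s ∈ Ω, p s * ∑ i ∈ s, w i := by
  simp_rw [sum_filter, mul_sum]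
  rw [sum_comm]
  refine sum_congr rfl fun s _ => ?_
  rw [← sum_filter_add_sum_filter_not univ (fun i => i ∈ s)]
  rw [sum_eq_zero (s := univ.filter (fun i => i ∉ s)) (fun i hi => by simp_all), add_zero]
  simp only [filter_mem_eq_inter, univ_inter]
  exact sum_congr rfl fun i hi => by simp [hi, mul_comm]

/-- (Lemma 4.) Under Assumption 1 and the stability condition, if `γ > 0`
and `ρ ≥ 1 − γ ζ ρ_min²`, then the per-component products `Π_k = ∏_{i∈V_k} σ_i` satisfy
`min_k Π_k/ρ̂_k ≥ (1 − 3γ) max_k Π_k/ρ̂_k`. -/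
theorem per_component_products_close
    {V : Type*} [Fintype V] [DecidableEq V] {K : ℕ} (G : SimpleGraph V)
    (hKne : (univ : Finset (Fin K)).Nonempty)
    (c : V → Fin K) (hcsurj : Function.Surjective c)
    (Ω : Finset (Finset V))
    (hΩ : ∀ s : Finset V, s ∈ Ω ↔ ∀ i ∈ s, ∀ j ∈ s, i ≠ j → ¬ G.Adj i j)
    (hindep : ∀ k : Fin K, univ.filter (fun i => c i = k) ∈ Ω)
    (σ : V → ℝ) (hσ : ∀ i, 0 < σ i)
    (Z : ℝ) (hZ : Z = ∑ s ∈ Ω, ∏ i ∈ s, σ i)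
    (π : Finset V → ℝ) (hπ : ∀ s, π s = (∏ i ∈ s, σ i) / Z)
    (θ : V → ℝ) (hθ : ∀ i, θ i = ∑ s ∈ Ω.filter (fun s => i ∈ s), π s)
    (M : Fin K → ℕ) (hM : ∀ k, M k = (univ.filter (fun i => c i = k)).card)
    (H : Finset V → ℝ)
    (hH : ∀ s : Finset V,
      H s = ∑ k : Fin K, ((s.filter (fun i => c i = k)).card : ℝ) / (M k : ℝ))
    (Ωstar : Finset (Finset V))
    (hΩstar : Ωstar = (univ : Finset (Fin K)).image
      (fun k => univ.filter (fun i => c i = k)))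
    (hH1 : ∀ s ∈ Ω, H s ≤ 1)
    (hHlt : ∀ s ∈ Ω, s ∉ Ωstar → H s < 1)
    (hne : (Ω \ Ωstar).Nonempty)
    (ζ : ℝ) (hζ : ζ = 1 - (Ω \ Ωstar).sup' hne H) (hζpos : 0 < ζ)
    (ρhat : Fin K → ℝ)
    (ρ : ℝ) (hρ : ρ = ∑ k : Fin K, ρhat k)
    (ρmin : ℝ) (hρmin : ρmin = univ.inf' hKne ρhat) (hρminpos : 0 < ρmin)
    (hstab : ∀ i : V, ρhat (c i) < θ i)
    (γ : ℝ) (hγ : 0 < γ)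
    (hρbig : ρ ≥ 1 - γ * ζ * ρmin ^ 2) :
    univ.inf' hKne (fun k => (∏ i ∈ univ.filter (fun i => c i = k), σ i) / ρhat k)
      ≥ (1 - 3 * γ) *
        univ.sup' hKne (fun k => (∏ i ∈ univ.filter (fun i => c i = k), σ i) / ρhat k) := by
  set F : Fin K → Finset V := fun k => univ.filter (fun i => c i = k) with hF
  set w : V → ℝ := fun i => (M (c i) : ℝ)⁻¹ with hw
  have hw0 : ∀ i, 0 ≤ w i := fun i => by positivity
  have hprod : ∀ s : Finset V, 0 < ∏ i ∈ s, σ i := fun s => prod_pos fun i _ => hσ i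
  have hZpos : 0 < Z := by
    rw [hZ]
    exact sum_pos (fun s _ => hprod s) (hne.mono sdiff_subset)
  have hπ0 : ∀ s, 0 ≤ π s := fun s => by
    rw [hπ]
    exact (div_pos (hprod s) hZpos).le
  have hπsum : ∑ s ∈ Ω, π s = 1 := by
    simp_rw [hπ, ← sum_div, ← hZ]
    exact div_self hZpos.ne'
  have hHw : ∀ s, H s = ∑ i ∈ s, w i := fun s => by
    rw [hH, sum_fiber_card_div c (fun k => (M k : ℝ))]
  have hfiber : ∀ k a, ∑ i ∈ F k, w i * a = a := fun k a => by
    simp only [hw, hM]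
    exact sum_fiber_card_inv_mul hcsurj k a
  have hθsum : ∑ i, w i * θ i = ∑ s ∈ Ω, π s * H s := by
    simp_rw [hθ, hHw]
    exact sum_mul_sum_filter_mem Ω w π
  have hρsum : ∑ i, w i * ρhat (c i) = ρ := by
    rw [hρ, ← sum_fiberwise univ c]
    refine sum_congr rfl fun k _ => ?_
    rw [← hfiber k (ρhat k)]
    exact sum_congr rfl fun i hi => by rw [(mem_filter.1 hi).2]
  have hstar : Ωstar ⊆ Ω := by
    rw [hΩstar]
    exact image_subset_iff.2 fun k _ => hindep k
  set q : ℝ := ∑ s ∈ Ω \ Ωstar, π s with hq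
  have hq0 : 0 ≤ q := sum_nonneg fun s _ => hπ0 s
  have hEH : ∑ s ∈ Ω, π s * H s ≤ 1 - ζ * q := by
    have hout : ∑ s ∈ Ω \ Ωstar, π s * H s ≤ ∑ s ∈ Ω \ Ωstar, π s * (1 - ζ) :=
      sum_le_sum fun s hs => mul_le_mul_of_nonneg_left
        (by linarith [le_sup' H hs]) (hπ0 s)
    have hin : ∑ s ∈ Ωstar, π s * H s ≤ ∑ s ∈ Ωstar, π s :=
      sum_le_sum fun s hs => mul_le_of_le_one_right (hπ0 s) (hH1 s (hstar hs))
    rw [← sum_mul, ← hq] at hout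
    rw [← sum_sdiff hstar, ← hq] at hπsum
    rw [← sum_sdiff hstar]
    linarith
  have hexc : ∑ i, w i * (θ i - ρhat (c i)) ≤ 1 - ζ * q - ρ := by
    simp_rw [mul_sub, sum_sub_distrib, hθsum, hρsum]
    linarith
  have hexc0 : ∀ i, 0 ≤ w i * (θ i - ρhat (c i)) := fun i =>
    mul_nonneg (hw0 i) (sub_nonneg.2 (hstab i).le)
  have hqle : q ≤ γ * ρmin ^ 2 := by
    have : 0 ≤ ∑ i, w i * (θ i - ρhat (c i)) := sum_nonneg fun i _ => hexc0 i
    exact le_of_mul_le_mul_left (by linarith) hζpos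
  have hζ1 : ζ ≤ 1 := by
    obtain ⟨s, hs⟩ := hne
    have h0 : 0 ≤ H s := by
      rw [hHw]
      exact sum_nonneg fun i _ => hw0 i
    linarith [le_sup' H hs]
  have hmin : ∀ k, ρmin ≤ ρhat k := fun k => hρmin ▸ inf'_le ρhat (mem_univ k)
  have hlower : ∀ k, ρhat k - q ≤ π (F k) := fun k => by
    obtain ⟨i, rfl⟩ := hcsurj k
    have hsub : Ω.filter (fun s => i ∈ s) ⊆ insert (F (c i)) (Ω \ Ωstar) := by
      intro s hs
      obtain ⟨hsΩ, his⟩ := mem_filter.1 hs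
      by_cases hss : s ∈ Ωstar
      · rw [hΩstar] at hss
        obtain ⟨k, -, rfl⟩ := mem_image.1 hss
        rw [(mem_filter.1 his).2]
        exact mem_insert_self _ _
      · exact mem_insert_of_mem (mem_sdiff.2 ⟨hsΩ, hss⟩)
    have hnot : F (c i) ∉ Ω \ Ωstar := fun h =>
      (mem_sdiff.1 h).2 (hΩstar ▸ mem_image_of_mem F (mem_univ (c i)))
    have hle := sum_le_sum_of_subset_of_nonneg hsub fun s _ _ => hπ0 s
    rw [sum_insert hnot, ← hθ, ← hq] at hle
    linarith [hstab i]
  have hupper : ∀ k, π (F k) ≤ ρhat k + γ * ρmin ^ 2 := fun k => by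
    have h1 : π (F k) - ρhat k ≤ ∑ i ∈ F k, w i * (θ i - ρhat (c i)) := by
      rw [← hfiber k (π (F k) - ρhat k)]
      refine sum_le_sum fun i hi => mul_le_mul_of_nonneg_left ?_ (hw0 i)
      have hle : π (F k) ≤ θ i := by
        rw [hθ]
        exact single_le_sum (f := π) (fun s _ => hπ0 s) (mem_filter.2 ⟨hindep k, hi⟩)
      rw [(mem_filter.1 hi).2]
      linarith
    have h2 : ∑ i ∈ F k, w i * (θ i - ρhat (c i)) ≤ ∑ i, w i * (θ i - ρhat (c i)) :=
      sum_le_sum_of_subset_of_nonneg (subset_univ _) fun i _ _ => hexc0 i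
    have h3 : ζ * (γ * ρmin ^ 2) ≤ 1 * (γ * ρmin ^ 2) :=
      mul_le_mul_of_nonneg_right hζ1 (by positivity)
    have h4 : 0 ≤ ζ * q := mul_nonneg hζpos.le hq0
    linarith
  have hmin1 : ρmin ≤ 1 := by
    obtain ⟨k, -⟩ := hKne
    obtain ⟨i, rfl⟩ := hcsurj k
    have : θ i ≤ 1 := by
      rw [hθ, ← hπsum]
      exact sum_le_sum_of_subset_of_nonneg (filter_subset _ _) fun s _ _ => hπ0 s
    linarith [hmin (c i), hstab i]
  have hZπ : ∀ k, ∏ i ∈ F k, σ i = Z * π (F k) := fun k => by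
    rw [hπ, mul_div_cancel₀ _ hZpos.ne']
  have hpos : ∀ k, 0 < ρhat k := fun k => hρminpos.trans_le (hmin k)
  have hscale : ∀ k, γ * ρmin ^ 2 ≤ γ * ρmin * ρhat k := fun k => by
    rw [sq, ← mul_assoc]
    exact mul_le_mul_of_nonneg_left (hmin k) (by positivity)
  have hratio_lower : ∀ k, Z * (1 - γ * ρmin) ≤ (∏ i ∈ F k, σ i) / ρhat k := fun k => by
    rw [le_div_iff₀ (hpos k), hZπ, mul_assoc]
    exact mul_le_mul_of_nonneg_left (by linarith [hlower k, hscale k]) hZpos.le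
  have hratio_upper : ∀ k, (∏ i ∈ F k, σ i) / ρhat k ≤ Z * (1 + γ * ρmin) := fun k => by
    rw [div_le_iff₀ (hpos k), hZπ, mul_assoc]
    exact mul_le_mul_of_nonneg_left (by linarith [hupper k, hscale k]) hZpos.le
  refine le_inf' _ _ fun k _ => ?_
  obtain ⟨l, -, hl⟩ := exists_mem_eq_sup' hKne (fun k => (∏ i ∈ F k, σ i) / ρhat k)
  rw [hl]
  rcases le_total (1 - 3 * γ) 0 with hneg | hnonneg
  · exact (mul_nonpos_of_nonpos_of_nonneg hneg (div_pos (hprod _) (hpos l)).le).trans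
      (div_pos (hprod _) (hpos k)).le
  · refine (mul_le_mul_of_nonneg_left (hratio_upper l) hnonneg).trans
      (le_trans ?_ (hratio_lower k))
    have hγρ : γ * ρmin ≤ γ := mul_le_of_le_one_right hγ.le hmin1
    have hγρ2 : 0 ≤ γ * (γ * ρmin) := by positivity
    rw [mul_left_comm]
    exact mul_le_mul_of_nonneg_left (by linarith) hZpos.le
end

section
/- Let γ ∈ (0, 1/3) and assume ρ ≥ 1 − γ ζ ρ_min². Then for every u ∈ Ω, ∏_{j∈V} σ_j^{u_j} ≤ ( σ*/((1−3γ) ρ_min) )^{H(u)}. Consequently, if σ*/((1−3γ) ρ_min) ≥ 1, then for every nonempty A ⊆ Ω, max_{u∈A} ∏_{j∈V} σ_j^{u_j} ≤ ( σ*/((1−3γ) ρ_min) )^{max_{u∈A} H(u)}. (This is the content of Lemma 5.) -/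
open Finset

/-- A product over `u` of values depending only on the class of each element is bounded by a power
of any `B` that dominates every full-class product `f k ^ M k`. -/
theorem prod_comp_le_rpow_sum_card_div {V κ : Type*} [Fintype κ] [DecidableEq κ]
    (c : V → κ) (f : κ → ℝ) (hf : ∀ k, 0 < f k) (M : κ → ℕ) (hM : ∀ k, 0 < M k)
    (B : ℝ) (hB : 0 < B) (hfB : ∀ k, f k ^ M k ≤ B) (u : Finset V) :
    ∏ j ∈ u, f (c j) ≤ B ^ (∑ k, (#{i ∈ u | c i = k} : ℝ) / (M k : ℝ)) := by
  rw [← Finset.prod_fiberwise' u c f, Real.rpow_sum_of_pos hB]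
  refine Finset.prod_le_prod (fun k _ => prod_nonneg fun _ _ => (hf k).le) fun k _ => ?_
  have hMk : (M k : ℝ) ≠ 0 := by exact_mod_cast (hM k).ne'
  have hroot : f k ≤ B ^ (1 / (M k : ℝ)) := by
    rw [one_div]
    exact (Real.le_rpow_inv_iff_of_pos (hf k).le hB.le (by exact_mod_cast hM k)).2
      (by simpa using hfB k)
  calc ∏ _j ∈ u with c _j = k, f k = f k ^ #{i ∈ u | c i = k} := by simp
    _ ≤ (B ^ (1 / (M k : ℝ))) ^ #{i ∈ u | c i = k} := by gcongr; exact (hf k).le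
    _ = B ^ ((#{i ∈ u | c i = k} : ℝ) / (M k : ℝ)) := by
      rw [← Real.rpow_mul_natCast hB.le]
      ring_nf

/-- The weighted sum of the normalised class counts in terms of the weights of the sets
containing each point. -/
theorem sum_mul_sum_card_div {V κ : Type*} [Fintype V] [DecidableEq V] [Fintype κ]
    [DecidableEq κ] (c : V → κ) (Ω : Finset (Finset V)) (p : Finset V → ℝ) (M : κ → ℕ) :
    ∑ s ∈ Ω, p s * ∑ k, (#{i ∈ s | c i = k} : ℝ) / (M k : ℝ) =
      ∑ k, (∑ i with c i = k, ∑ s ∈ Ω with i ∈ s, p s) / (M k : ℝ) := by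
  simp_rw [mul_sum]
  rw [sum_comm]
  refine sum_congr rfl fun k _ => ?_
  simp_rw [← mul_div_assoc]
  rw [← sum_div]
  congr 1
  have hcount (s : Finset V) :
      (#{i ∈ s | c i = k} : ℝ) = ∑ i with c i = k, if i ∈ s then (1 : ℝ) else 0 := by
    rw [sum_boole, filter_filter]
    congr 2
    ext i
    simp [and_comm]
  simp_rw [hcount, mul_sum]
  rw [sum_comm]
  refine sum_congr rfl fun i _ => ?_
  simp [sum_filter]

/-- (Lemma 5.) With equal activation rates within components, for
`γ ∈ (0, 1/3)` and `ρ ≥ 1 − γ ζ ρ_min²`, every feasible state `u` satisfies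
`∏_{j∈V} σ_j^{u_j} ≤ (σ*/((1−3γ)ρ_min))^{H(u)}`; consequently, if
`σ*/((1−3γ)ρ_min) ≥ 1`, then for every nonempty `A ⊆ Ω`,
`max_{u∈A} ∏_j σ_j^{u_j} ≤ (σ*/((1−3γ)ρ_min))^{max_{u∈A} H(u)}`. -/
theorem product_bound_via_H
    {V : Type*} [Fintype V] [DecidableEq V] {K : ℕ} (G : SimpleGraph V)
    (hKne : (univ : Finset (Fin K)).Nonempty)
    (c : V → Fin K) (hcsurj : Function.Surjective c)
    (Ω : Finset (Finset V))
    (hΩ : ∀ s : Finset V, s ∈ Ω ↔ ∀ i ∈ s, ∀ j ∈ s, i ≠ j → ¬ G.Adj i j)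
    (hindep : ∀ k : Fin K, univ.filter (fun i => c i = k) ∈ Ω)
    (σ : V → ℝ) (hσ : ∀ i, 0 < σ i)
    (σhat : Fin K → ℝ) (hσhat : ∀ i : V, σ i = σhat (c i))
    (Z : ℝ) (hZ : Z = ∑ s ∈ Ω, ∏ i ∈ s, σ i)
    (π : Finset V → ℝ) (hπ : ∀ s, π s = (∏ i ∈ s, σ i) / Z)
    (θ : V → ℝ) (hθ : ∀ i, θ i = ∑ s ∈ Ω.filter (fun s => i ∈ s), π s)
    (M : Fin K → ℕ) (hM : ∀ k, M k = (univ.filter (fun i => c i = k)).card)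
    (σstar : ℝ) (hσstar : σstar = univ.inf' hKne (fun k => σhat k ^ (M k)))
    (H : Finset V → ℝ)
    (hH : ∀ s : Finset V,
      H s = ∑ k : Fin K, ((s.filter (fun i => c i = k)).card : ℝ) / (M k : ℝ))
    (Ωstar : Finset (Finset V))
    (hΩstar : Ωstar = (univ : Finset (Fin K)).image
      (fun k => univ.filter (fun i => c i = k)))
    (hH1 : ∀ s ∈ Ω, H s ≤ 1)
    (hHlt : ∀ s ∈ Ω, s ∉ Ωstar → H s < 1)
    (hne : (Ω \ Ωstar).Nonempty)
    (ζ : ℝ) (hζ : ζ = 1 - (Ω \ Ωstar).sup' hne H) (hζpos : 0 < ζ)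
    (ρhat : Fin K → ℝ)
    (ρ : ℝ) (hρ : ρ = ∑ k : Fin K, ρhat k)
    (ρmin : ℝ) (hρmin : ρmin = univ.inf' hKne ρhat) (hρminpos : 0 < ρmin)
    (hstab : ∀ i : V, ρhat (c i) < θ i)
    (γ : ℝ) (hγ0 : 0 < γ) (hγ3 : γ < 1 / 3)
    (hρbig : ρ ≥ 1 - γ * ζ * ρmin ^ 2) :
    (∀ u ∈ Ω, ∏ j ∈ u, σ j ≤ (σstar / ((1 - 3 * γ) * ρmin)) ^ (H u)) ∧
    (σstar / ((1 - 3 * γ) * ρmin) ≥ 1 →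
      ∀ (A : Finset (Finset V)) (hA : A.Nonempty), A ⊆ Ω →
        A.sup' hA (fun u => ∏ j ∈ u, σ j)
          ≤ (σstar / ((1 - 3 * γ) * ρmin)) ^ (A.sup' hA H)) := by
  have hfhat (k : Fin K) : 0 < σhat k := by
    obtain ⟨i, rfl⟩ := hcsurj k
    exact hσhat i ▸ hσ i
  have hMpos (k : Fin K) : 0 < M k := by
    obtain ⟨i, rfl⟩ := hcsurj k
    rw [hM, card_pos]
    exact ⟨i, by simp⟩
  have hprod (s : Finset V) : 0 < ∏ i ∈ s, σ i := prod_pos fun i _ => hσ i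
  have hZpos : 0 < Z := by
    rw [hZ]
    exact sum_pos (fun s _ => hprod s) (hne.mono sdiff_subset)
  have hπpos (s : Finset V) : 0 < π s := by
    rw [hπ]
    exact div_pos (hprod s) hZpos
  have hπsum : ∑ s ∈ Ω, π s = 1 := by
    simp_rw [hπ]
    rw [← sum_div, ← hZ, div_self hZpos.ne']
  have hπle (s : Finset V) (hs : s ∈ Ω) : π s ≤ 1 :=
    hπsum ▸ single_le_sum (fun t _ => (hπpos t).le) hs
  have hmin (k : Fin K) : ρmin ≤ ρhat k := hρmin ▸ inf'_le _ (mem_univ k)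
  have hρmin1 : ρmin ≤ 1 := by
    obtain ⟨k, -⟩ := hKne
    obtain ⟨i, rfl⟩ := hcsurj k
    have hle : θ i ≤ 1 := by
      rw [hθ, ← hπsum]
      exact sum_le_sum_of_subset_of_nonneg (filter_subset _ _) fun s _ _ => (hπpos s).le
    linarith [hmin (c i), hstab i]
  have hEH : ρ ≤ ∑ s ∈ Ω, π s * H s := by
    simp_rw [hH]
    rw [sum_mul_sum_card_div, hρ]
    refine sum_le_sum fun k _ => ?_
    rw [le_div_iff₀ (by exact_mod_cast hMpos k), hM, mul_comm, ← nsmul_eq_mul]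
    refine card_nsmul_le_sum _ _ _ fun i hi => ?_
    obtain rfl := (mem_filter.1 hi).2
    exact hθ i ▸ (hstab i).le
  have hdeficit : ζ * ∑ s ∈ Ω \ Ωstar, π s ≤ ∑ s ∈ Ω, π s * (1 - H s) := by
    rw [mul_sum]
    calc ∑ s ∈ Ω \ Ωstar, ζ * π s ≤ ∑ s ∈ Ω \ Ωstar, π s * (1 - H s) := by
          refine sum_le_sum fun s hs => ?_
          rw [mul_comm]
          have hle : H s ≤ (Ω \ Ωstar).sup' hne H := le_sup' H hs
          exact mul_le_mul_of_nonneg_left (by linarith) (hπpos s).le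
      _ ≤ _ := sum_le_sum_of_subset_of_nonneg sdiff_subset fun s hs _ =>
          mul_nonneg (hπpos s).le (by linarith [hH1 s hs])
  have hrare : ∑ s ∈ Ω \ Ωstar, π s ≤ γ * ρmin ^ 2 := by
    have hsub : ∑ s ∈ Ω, π s * (1 - H s) = 1 - ∑ s ∈ Ω, π s * H s := by
      simp_rw [mul_sub, mul_one, sum_sub_distrib, hπsum]
    refine le_of_mul_le_mul_left ?_ hζpos
    linarith
  have hcomp (k : Fin K) : (1 - 3 * γ) * ρmin ≤ π {i | c i = k} := by
    obtain ⟨i, rfl⟩ := hcsurj k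
    have hcover : θ i ≤ π {j | c j = c i} + ∑ s ∈ Ω \ Ωstar, π s := by
      rw [hθ]
      calc ∑ s ∈ Ω with i ∈ s, π s
          ≤ ∑ s ∈ insert (univ.filter fun j => c j = c i) (Ω \ Ωstar), π s := by
            refine sum_le_sum_of_subset_of_nonneg (fun s hs => ?_) fun s _ _ => (hπpos s).le
            obtain ⟨hsΩ, his⟩ := mem_filter.1 hs
            by_cases hstar : s ∈ Ωstar
            · rw [hΩstar] at hstar
              obtain ⟨l, -, rfl⟩ := mem_image.1 hstar
              obtain rfl := (mem_filter.1 his).2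
              exact mem_insert_self _ _
            · exact mem_insert_of_mem (mem_sdiff.2 ⟨hsΩ, hstar⟩)
        _ = _ := sum_insert (by simp [hΩstar])
    have hsq : γ * ρmin ^ 2 ≤ γ * ρmin :=
      mul_le_mul_of_nonneg_left (by nlinarith) hγ0.le
    nlinarith [hmin (c i), hstab i, mul_pos hγ0 hρminpos]
  have hpow (k : Fin K) : σhat k ^ M k = π {i | c i = k} * Z := by
    rw [hπ, div_mul_cancel₀ _ hZpos.ne', hM, ← prod_const]
    refine prod_congr rfl fun i hi => ?_
    rw [hσhat, (mem_filter.1 hi).2]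
  have hbpos : 0 < (1 - 3 * γ) * ρmin := mul_pos (by linarith) hρminpos
  have hstarpos : 0 < σstar := by
    rw [hσstar, lt_inf'_iff]
    exact fun k _ => pow_pos (hfhat k) _
  have hdom (k : Fin K) : σhat k ^ M k ≤ σstar / ((1 - 3 * γ) * ρmin) := by
    rw [le_div_iff₀ hbpos, hσstar, le_inf'_iff]
    intro l _
    rw [hpow k, hpow l]
    have hle : π {i | c i = k} * ((1 - 3 * γ) * ρmin) ≤ π {i | c i = l} :=
      (mul_le_of_le_one_left hbpos.le (hπle _ (hindep k))).trans (hcomp l)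
    nlinarith
  have hbound (u : Finset V) :
      ∏ j ∈ u, σ j ≤ (σstar / ((1 - 3 * γ) * ρmin)) ^ (H u) := by
    simp_rw [hσhat]
    rw [hH]
    exact prod_comp_le_rpow_sum_card_div c σhat hfhat M hMpos _ (div_pos hstarpos hbpos) hdom u
  refine ⟨fun u _ => hbound u, fun hone A hA _ => sup'_le hA _ fun u hu => ?_⟩
  exact (hbound u).trans (Real.rpow_le_rpow_of_exponent_le hone (le_sup' H hu))
end

section
/- Let γ ∈ (0, 1/3) and assume ρ ≥ 1 − γ ζ ρ_min². Then: (a) for every k, σ̂_k ≥ ρ̂_k/(1−ρ), and in particular σ* ≥ (ρ̂_{k*}/(1−ρ))^{M_{k*}} where k* attains min_k σ̂_k^{M_k}; and (b) for every subset A ⊆ Ω and every h ∈ [0,1] such that H(u) ≤ h for all u ∈ A, π(A) ≤ 2^N (σ*)^{h−1} / ((1−3γ) ρ_min). (These are the key estimates in the proof of Lemma 6.) -/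
open Finset

/-- A clique that meets a fibre of `c` in at most one vertex and has as many vertices as there are
fibres is a transversal, so sums over it are sums over the fibres. -/
lemma sum_clique_eq_sum_components {V : Type*} [Fintype V] [DecidableEq V] {K : ℕ}
    (G : SimpleGraph V) (c : V → Fin K) (hc : ∀ i j, i ≠ j → c i = c j → ¬ G.Adj i j)
    (C : Finset V) (hcard : C.card = K) (hC : ∀ i ∈ C, ∀ j ∈ C, i ≠ j → G.Adj i j)
    (f : Fin K → ℝ) : ∑ j ∈ C, f (c j) = ∑ k, f k := by
  have hinj : Set.InjOn c C := fun i hi j hj hij => by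
    by_contra hne
    exact hc i j hne hij (hC i hi j hj hne)
  have himg : C.image c = univ := by
    rw [← Finset.card_eq_iff_eq_univ, Finset.card_image_of_injOn hinj, hcard, Fintype.card_fin]
  rw [← himg, Finset.sum_image hinj]

/-- At most one vertex of a clique is active in a feasible state. -/
lemma sum_active_clique_add_sum_disjoint_le {V : Type*} [DecidableEq V]
    (G : SimpleGraph V) (Ω : Finset (Finset V))
    (hΩ : ∀ s ∈ Ω, ∀ i ∈ s, ∀ j ∈ s, i ≠ j → ¬ G.Adj i j)
    (w : Finset V → ℝ) (hw : ∀ s, 0 ≤ w s)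
    (C : Finset V) (hC : ∀ i ∈ C, ∀ j ∈ C, i ≠ j → G.Adj i j) :
    ∑ j ∈ C, ∑ s ∈ Ω with j ∈ s, w s + ∑ s ∈ Ω with Disjoint C s, w s ≤ ∑ s ∈ Ω, w s := by
  simp_rw [Finset.sum_filter]
  rw [Finset.sum_comm, ← Finset.sum_add_distrib]
  refine Finset.sum_le_sum fun s hs => ?_
  rw [← Finset.sum_filter, Finset.sum_const, nsmul_eq_mul, Finset.filter_mem_eq_inter]
  by_cases hd : Disjoint C s
  · simp [hd, Finset.disjoint_iff_inter_eq_empty.mp hd]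
  · have hle : (C ∩ s).card ≤ 1 := by
      refine Finset.card_le_one.mpr fun a ha b hb => ?_
      rw [Finset.mem_inter] at ha hb
      by_contra hab
      exact hΩ s hs a ha.2 b hb.2 hab (hC a ha.1 b hb.1 hab)
    have hle' : ((C ∩ s).card : ℝ) ≤ 1 := by exact_mod_cast hle
    rw [if_neg hd, add_zero]
    exact mul_le_of_le_one_left (hw s) hle'

/-- Deactivating a clique vertex leaves a feasible state in which the whole clique is inactive. -/
lemma sum_active_le_mul_sum_disjoint {V : Type*} [DecidableEq V]
    (G : SimpleGraph V) (Ω : Finset (Finset V))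
    (hΩ : ∀ s : Finset V, s ∈ Ω ↔ ∀ i ∈ s, ∀ j ∈ s, i ≠ j → ¬ G.Adj i j)
    (σ : V → ℝ) (hσ : ∀ i, 0 < σ i)
    (C : Finset V) (hC : ∀ i ∈ C, ∀ j ∈ C, i ≠ j → G.Adj i j) (i : V) (hi : i ∈ C) :
    ∑ s ∈ Ω with i ∈ s, ∏ j ∈ s, σ j ≤
      σ i * ∑ s ∈ Ω with Disjoint C s, ∏ j ∈ s, σ j := by
  have hinj : Set.InjOn (fun s : Finset V => s.erase i) (Ω.filter (fun s => i ∈ s)) := by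
    intro s hs t ht hst
    simp only [Finset.coe_filter, Set.mem_ofPred_eq] at hs ht
    rw [← Finset.insert_erase hs.2, ← Finset.insert_erase ht.2]
    exact congrArg (insert i) hst
  have hsub : (Ω.filter (fun s => i ∈ s)).image (fun s => s.erase i) ⊆
      Ω.filter (fun s => Disjoint C s) := by
    intro t ht
    obtain ⟨s, hs, rfl⟩ := Finset.mem_image.mp ht
    rw [Finset.mem_filter] at hs ⊢
    have hfeas := (hΩ s).mp hs.1
    refine ⟨(hΩ _).mpr fun a ha b hb => hfeas a (Finset.mem_of_mem_erase ha) b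
      (Finset.mem_of_mem_erase hb), Finset.disjoint_left.mpr fun a haC ha => ?_⟩
    have hai := Finset.ne_of_mem_erase ha
    exact hfeas a (Finset.mem_of_mem_erase ha) i hs.2 hai (hC a haC i hi hai)
  calc ∑ s ∈ Ω with i ∈ s, ∏ j ∈ s, σ j
      = σ i * ∑ s ∈ Ω with i ∈ s, ∏ j ∈ s.erase i, σ j := by
        rw [Finset.mul_sum]
        exact Finset.sum_congr rfl fun s hs =>
          (Finset.mul_prod_erase s σ (Finset.mem_filter.mp hs).2).symm
    _ = σ i * ∑ t ∈ (Ω.filter (fun s => i ∈ s)).image (fun s => s.erase i), ∏ j ∈ t, σ j := by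
        rw [Finset.sum_image hinj]
    _ ≤ _ := mul_le_mul_of_nonneg_left (Finset.sum_le_sum_of_subset_of_nonneg hsub
        fun t _ _ => Finset.prod_nonneg fun j _ => (hσ j).le) (hσ i).le

/-- If every component's full weight is at most `Z`, the weight of a state is at most `Z` raised to
the sum of its component occupancy fractions. -/
lemma prod_le_rpow_sum_fractions {V : Type*} {K : ℕ} [DecidableEq V]
    (c : V → Fin K) (a : Fin K → ℝ) (ha : ∀ k, 0 < a k) (M : Fin K → ℕ) (hM : ∀ k, M k ≠ 0)
    (Z : ℝ) (hZ : 0 < Z) (haZ : ∀ k, a k ^ M k ≤ Z) (s : Finset V) :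
    ∏ i ∈ s, a (c i) ≤
      Z ^ (∑ k, ((s.filter (fun i => c i = k)).card : ℝ) / (M k : ℝ)) := by
  have hterm : ∀ k, a k ≤ Z ^ ((M k : ℝ)⁻¹) := fun k => by
    rw [← Real.pow_rpow_inv_natCast (ha k).le (hM k)]
    exact Real.rpow_le_rpow (pow_nonneg (ha k).le _) (haZ k) (by positivity)
  rw [← Finset.prod_fiberwise s c, Real.rpow_sum_of_pos hZ]
  refine Finset.prod_le_prod (fun k _ => Finset.prod_nonneg fun i _ => (ha _).le) fun k _ => ?_
  rw [Finset.prod_congr rfl (fun i hi => by rw [(Finset.mem_filter.mp hi).2] :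
    ∀ i ∈ s.filter (fun i => c i = k), a (c i) = a k), Finset.prod_const,
    div_eq_inv_mul, Real.rpow_mul_natCast hZ.le]
  exact pow_le_pow_left₀ (ha k).le (hterm k) _




/-- (Key estimates of Lemma 6.) With equal activation rates within
components, `γ ∈ (0,1/3)` and `ρ ≥ 1 − γ ζ ρ_min²`:
(a) `σ̂_k ≥ ρ̂_k/(1−ρ)` for every `k`, and in particular
`σ* ≥ (ρ̂_{k*}/(1−ρ))^{M_{k*}}` for the minimizing index `k*`; and
(b) for every `A ⊆ Ω` and `h ∈ [0,1]` with `H(u) ≤ h` for all `u ∈ A`,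
`π(A) ≤ 2^N (σ*)^{h−1}/((1−3γ) ρ_min)`. -/
theorem sigma_and_pi_estimates
    {V : Type*} [Fintype V] [DecidableEq V] {K : ℕ} (G : SimpleGraph V)
    (hKne : (univ : Finset (Fin K)).Nonempty)
    (c : V → Fin K) (hcsurj : Function.Surjective c)
    (Ω : Finset (Finset V))
    (hΩ : ∀ s : Finset V, s ∈ Ω ↔ ∀ i ∈ s, ∀ j ∈ s, i ≠ j → ¬ G.Adj i j)
    (hindep : ∀ k : Fin K, univ.filter (fun i => c i = k) ∈ Ω)
    (hcliques : ∀ i : V, ∃ C : Finset V, i ∈ C ∧ C.card = K ∧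
      ∀ i' ∈ C, ∀ j ∈ C, i' ≠ j → G.Adj i' j)
    (σ : V → ℝ) (hσ : ∀ i, 0 < σ i)
    (σhat : Fin K → ℝ) (hσhat : ∀ i : V, σ i = σhat (c i))
    (Z : ℝ) (hZ : Z = ∑ s ∈ Ω, ∏ i ∈ s, σ i)
    (π : Finset V → ℝ) (hπ : ∀ s, π s = (∏ i ∈ s, σ i) / Z)
    (θ : V → ℝ) (hθ : ∀ i, θ i = ∑ s ∈ Ω.filter (fun s => i ∈ s), π s)
    (M : Fin K → ℕ) (hM : ∀ k, M k = (univ.filter (fun i => c i = k)).card)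
    (σstar : ℝ) (hσstar : σstar = univ.inf' hKne (fun k => σhat k ^ (M k)))
    (kstar : Fin K) (hkstar : σhat kstar ^ (M kstar) = σstar)
    (H : Finset V → ℝ)
    (hH : ∀ s : Finset V,
      H s = ∑ k : Fin K, ((s.filter (fun i => c i = k)).card : ℝ) / (M k : ℝ))
    (Ωstar : Finset (Finset V))
    (hΩstar : Ωstar = (univ : Finset (Fin K)).image
      (fun k => univ.filter (fun i => c i = k)))
    (hH1 : ∀ s ∈ Ω, H s ≤ 1)
    (hHlt : ∀ s ∈ Ω, s ∉ Ωstar → H s < 1)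
    (hne : (Ω \ Ωstar).Nonempty)
    (ζ : ℝ) (hζ : ζ = 1 - (Ω \ Ωstar).sup' hne H) (hζpos : 0 < ζ)
    (ρhat : Fin K → ℝ)
    (ρ : ℝ) (hρ : ρ = ∑ k : Fin K, ρhat k)
    (ρmin : ℝ) (hρmin : ρmin = univ.inf' hKne ρhat) (hρminpos : 0 < ρmin)
    (hstab : ∀ i : V, ρhat (c i) < θ i)
    (γ : ℝ) (hγ0 : 0 < γ) (hγ3 : γ < 1 / 3)
    (hρbig : ρ ≥ 1 - γ * ζ * ρmin ^ 2) :
    ((∀ k : Fin K, σhat k ≥ ρhat k / (1 - ρ)) ∧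
      σstar ≥ (ρhat kstar / (1 - ρ)) ^ (M kstar)) ∧
    (∀ A : Finset (Finset V), A ⊆ Ω → ∀ h : ℝ, 0 ≤ h → h ≤ 1 →
      (∀ u ∈ A, H u ≤ h) →
      ∑ u ∈ A, π u ≤ 2 ^ (Fintype.card V) * σstar ^ (h - 1) /
        ((1 - 3 * γ) * ρmin)) := by
  have hσhatpos : ∀ k, 0 < σhat k := fun k => by
    obtain ⟨i, rfl⟩ := hcsurj k
    rw [← hσhat]
    exact hσ i
  have hM0 : ∀ k, M k ≠ 0 := fun k => by
    obtain ⟨i, hi⟩ := hcsurj k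
    rw [hM]
    exact Finset.card_ne_zero_of_mem (Finset.mem_filter.mpr ⟨Finset.mem_univ i, hi⟩)
  have hprod : ∀ s : Finset V, 0 < ∏ i ∈ s, σ i := fun s => Finset.prod_pos fun i _ => hσ i
  have hwZ : ∀ s ∈ Ω, ∏ i ∈ s, σ i ≤ Z := fun s hs => by
    rw [hZ]
    exact Finset.single_le_sum (f := fun s => ∏ i ∈ s, σ i) (fun t _ => (hprod t).le) hs
  have hZ1 : 1 ≤ Z := by simpa using hwZ ∅ ((hΩ ∅).mpr (by simp))
  have hZpos : 0 < Z := one_pos.trans_le hZ1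
  have hcomp : ∀ k, σhat k ^ M k ≤ Z := fun k => by
    refine le_trans (le_of_eq ?_) (hwZ _ (hindep k))
    rw [hM, ← Finset.prod_const]
    exact Finset.prod_congr rfl fun i hi => by rw [hσhat, (Finset.mem_filter.mp hi).2]
  have hπ0 : ∀ s, 0 ≤ π s := fun s => by
    rw [hπ]
    exact div_nonneg (hprod s).le hZpos.le
  have hπsum : ∑ s ∈ Ω, π s = 1 := by
    simp_rw [hπ]
    rw [← Finset.sum_div, ← hZ, div_self hZpos.ne']
  have hρhatpos : ∀ k, 0 < ρhat k := fun k =>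
    hρminpos.trans_le (hρmin ▸ Finset.inf'_le _ (Finset.mem_univ k))
  have hsame : ∀ i j, i ≠ j → c i = c j → ¬ G.Adj i j := fun i j hij hc =>
    (hΩ _).mp (hindep (c j)) i (by simp [hc]) j (by simp) hij
  have hrate : ∀ k, ρ < 1 ∧ ρhat k / (1 - ρ) ≤ σhat k := fun k => by
    obtain ⟨i, rfl⟩ := hcsurj k
    obtain ⟨C, hiC, hCcard, hC⟩ := hcliques i
    set P := ∑ s ∈ Ω with Disjoint C s, π s with hP
    have hP0 : 0 ≤ P := Finset.sum_nonneg fun s _ => hπ0 s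
    have hle := sum_active_clique_add_sum_disjoint_le G Ω (fun s hs => (hΩ s).mp hs) π hπ0 C hC
    simp_rw [← hθ] at hle
    have hlt : ∑ j ∈ C, ρhat (c j) < ∑ j ∈ C, θ j :=
      Finset.sum_lt_sum_of_nonempty ⟨i, hiC⟩ fun j _ => hstab j
    rw [sum_clique_eq_sum_components G c hsame C hCcard hC, ← hρ] at hlt
    have hPρ : P < 1 - ρ := by linarith
    have hθP : θ i ≤ σ i * P := by
      have hact := sum_active_le_mul_sum_disjoint G Ω hΩ σ hσ C hC i hiC
      rw [hθ, hP]
      simp_rw [hπ]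
      rw [← Finset.sum_div, ← Finset.sum_div, ← mul_div_assoc]
      exact div_le_div_of_nonneg_right hact hZpos.le
    have hρ1 : 0 < 1 - ρ := hP0.trans_lt hPρ
    refine ⟨by linarith, (div_le_iff₀ hρ1).mpr ?_⟩
    rw [← hσhat]
    exact ((hstab i).le.trans hθP).trans (mul_le_mul_of_nonneg_left hPρ.le (hσ i).le)
  have hρ1 : 0 < 1 - ρ := by linarith [(hrate kstar).1]
  refine ⟨⟨fun k => (hrate k).2, ?_⟩, fun A hA h _ hh1 hAh => ?_⟩
  · rw [← hkstar]
    exact pow_le_pow_left₀ (div_nonneg (hρhatpos _).le hρ1.le) (hrate kstar).2 _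
  have hσstarpos : 0 < σstar := hkstar ▸ pow_pos (hσhatpos kstar) _
  have hσstarZ : σstar ≤ Z := hkstar ▸ hcomp kstar
  have hstate : ∀ u ∈ A, π u ≤ σstar ^ (h - 1) := fun u hu => by
    have hw : ∏ i ∈ u, σ i ≤ Z ^ h := by
      simp_rw [hσhat]
      refine (prod_le_rpow_sum_fractions c σhat hσhatpos M hM0 Z hZpos hcomp u).trans ?_
      rw [← hH]
      exact Real.rpow_le_rpow_of_exponent_le hZ1 (hAh u hu)
    calc π u = (∏ i ∈ u, σ i) / Z := hπ u
      _ ≤ Z ^ h / Z := div_le_div_of_nonneg_right hw hZpos.le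
      _ = Z ^ (h - 1) := (Real.rpow_sub_one hZpos.ne' h).symm
      _ ≤ σstar ^ (h - 1) :=
        Real.rpow_le_rpow_of_nonpos hσstarpos hσstarZ (by linarith)
  have hcardA : (A.card : ℝ) ≤ 2 ^ Fintype.card V := by
    have hcard := Finset.card_le_univ A
    rw [Fintype.card_finset] at hcard
    exact_mod_cast hcard
  have hpow : 0 ≤ σstar ^ (h - 1) := Real.rpow_nonneg hσstarpos.le _
  have hρmin1 : ρmin ≤ 1 := by
    have hmin : ρmin ≤ ρhat kstar := hρmin ▸ Finset.inf'_le _ (Finset.mem_univ kstar)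
    have hsum : ρhat kstar ≤ ρ := hρ ▸
      Finset.single_le_sum (fun k _ => (hρhatpos k).le) (Finset.mem_univ kstar)
    linarith
  have hsumA : ∑ u ∈ A, π u ≤ 2 ^ Fintype.card V * σstar ^ (h - 1) := by
    refine (Finset.sum_le_card_nsmul A π _ hstate).trans ?_
    rw [nsmul_eq_mul]
    exact mul_le_mul_of_nonneg_right hcardA hpow
  refine hsumA.trans (le_div_self (by positivity) (mul_pos (by linarith) hρminpos) ?_)
  exact mul_le_one₀ (by linarith) hρminpos.le hρmin1
end
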